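/- arXiv:2404.04955 — 2 statements merged into one kernel-verified Lean document; each statement's English description precedes it below -/
import Mathlib

section
/- Let c>0 and let (t_j) be positive reals with t_j ~ c·j as j→∞. Put κ(j) = ( (1 + 4j/t_j)^{1/2} − 1 )/2, φ(c) = ( (1 + 4/c)^{1/2} − 1 )/2 and G(z) = (1 + 1/z) e^{1/(1+z)} for z>0. Then, as j→∞, Σ_{i=0}^{j} C(j,i) t_j^i / i! ~ (c² + 4c)^{-1/4} φ(c)^{-1} (2π t_j)^{-1/2} (G(κ(j)))^j. -/
open Filter Asymptotics
open scoped Topology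

noncomputable section

/-- The `n`-th Fourier coefficient of `θ ↦ exp (a * exp (θ * I))`. -/
lemma integral_exp_neg_mul_exp_mul_exp (a : ℂ) (n : ℕ) :
    ∫ θ in (-Real.pi)..Real.pi, Complex.exp (-θ * Complex.I) ^ n *
      Complex.exp (a * Complex.exp (θ * Complex.I)) = 2 * Real.pi * (a ^ n / n.factorial) := by
  have hper : Function.Periodic (fun θ : ℝ => Complex.exp (-θ * Complex.I) ^ n *
      Complex.exp (a * Complex.exp (θ * Complex.I))) (2 * Real.pi) := by
    intro θ
    have h₁ : Complex.exp (((θ + 2 * Real.pi : ℝ) : ℂ) * Complex.I)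
        = Complex.exp (θ * Complex.I) := by
      push_cast
      rw [add_mul, Complex.exp_add, Complex.exp_two_pi_mul_I, mul_one]
    simp only [neg_mul, Complex.exp_neg, h₁]
  have hshift := hper.intervalIntegral_add_eq (-Real.pi) 0
  rw [show -Real.pi + 2 * Real.pi = Real.pi by ring, zero_add] at hshift
  rw [hshift]
  have hd : DifferentiableOn ℂ (fun z => Complex.exp (a * z)) (Metric.closedBall 0 1) := by
    fun_prop
  have hc := hd.circleIntegral_one_div_sub_center_pow_smul one_pos n
  rw [iteratedDeriv_cexp_const_mul] at hc
  simp only [circleIntegral, deriv_circleMap, circleMap, zero_add, sub_zero, smul_eq_mul,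
    Complex.ofReal_one, one_mul, mul_zero, Complex.exp_zero, mul_one] at hc
  have he : ∀ θ : ℝ, Complex.exp (θ * Complex.I) * Complex.I *
      (1 / Complex.exp (θ * Complex.I) ^ (n + 1) * Complex.exp (a * Complex.exp (θ * Complex.I)))
      = Complex.I * (Complex.exp (-θ * Complex.I) ^ n *
        Complex.exp (a * Complex.exp (θ * Complex.I))) := by
    intro θ
    have := Complex.exp_ne_zero (θ * Complex.I)
    rw [neg_mul, Complex.exp_neg, inv_pow, pow_succ]
    field_simp
  simp only [he, intervalIntegral.integral_const_mul] at hc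
  apply mul_left_cancel₀ Complex.I_ne_zero
  rw [hc]
  ring

/-- The characteristic function, with argument reflected, of the difference of a Bernoulli
and a Poisson variable, both of mean `p`. -/
def bernoulliPoissonCharFun (p θ : ℝ) : ℂ :=
  (1 + p * (Complex.exp (-θ * Complex.I) - 1)) *
    Complex.exp (p * (Complex.exp (θ * Complex.I) - 1))

lemma continuous_bernoulliPoissonCharFun (p : ℝ) :
    Continuous (bernoulliPoissonCharFun p) := by
  unfold bernoulliPoissonCharFun
  fun_prop

lemma integral_bernoulliPoissonCharFun_pow (p : ℝ) (j : ℕ) :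
    ∫ θ in (-Real.pi)..Real.pi, bernoulliPoissonCharFun p θ ^ j =
      ((2 * Real.pi * (Real.exp (-(j * p)) * ∑ i ∈ Finset.range (j + 1),
        p ^ i * (1 - p) ^ (j - i) * j.choose i * ((j * p) ^ i / i.factorial)) : ℝ) : ℂ) := by
  have he : ∀ θ : ℝ, bernoulliPoissonCharFun p θ ^ j =
      ∑ i ∈ Finset.range (j + 1), (Complex.exp (-(j * p)) *
        (p ^ i * (1 - p) ^ (j - i) * j.choose i)) * (Complex.exp (-θ * Complex.I) ^ i *
        Complex.exp ((j * p) * Complex.exp (θ * Complex.I))) := by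
    intro θ
    unfold bernoulliPoissonCharFun
    rw [mul_pow, ← Complex.exp_nat_mul, show (j : ℂ) * (p * (Complex.exp (θ * Complex.I) - 1))
      = -(j * p) + (j * p) * Complex.exp (θ * Complex.I) by ring, Complex.exp_add,
      show (1 : ℂ) + p * (Complex.exp (-θ * Complex.I) - 1)
        = p * Complex.exp (-θ * Complex.I) + (1 - p) by ring, add_pow, Finset.sum_mul]
    refine Finset.sum_congr rfl fun i _ => ?_
    rw [mul_pow]
    ring
  simp only [he]
  rw [intervalIntegral.integral_finsetSum]
  · simp only [intervalIntegral.integral_const_mul, integral_exp_neg_mul_exp_mul_exp]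
    push_cast
    rw [Finset.mul_sum, Finset.mul_sum]
    refine Finset.sum_congr rfl fun i _ => ?_
    ring
  · intro i _
    apply Continuous.intervalIntegrable
    fun_prop

lemma norm_bernoulliPoissonCharFun_le {p : ℝ} (hp₀ : 0 ≤ p) (hp₁ : p ≤ 1) {θ : ℝ}
    (hθ : |θ| ≤ Real.pi) :
    ‖bernoulliPoissonCharFun p θ‖ ≤ Real.exp (-(p * (2 / Real.pi ^ 2 * θ ^ 2))) := by
  unfold bernoulliPoissonCharFun
  rw [norm_mul, Complex.norm_exp]
  have h₁ : ‖(1 : ℂ) + p * (Complex.exp (-θ * Complex.I) - 1)‖ ≤ 1 := by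
    rw [show (1 : ℂ) + p * (Complex.exp (-θ * Complex.I) - 1)
        = ((1 - p : ℝ) : ℂ) + p * Complex.exp (((-θ : ℝ) : ℂ) * Complex.I) by push_cast; ring]
    refine (norm_add_le _ _).trans ?_
    rw [norm_mul, Complex.norm_exp_ofReal_mul_I, Complex.norm_real, Complex.norm_real,
      Real.norm_of_nonneg hp₀, Real.norm_of_nonneg (by linarith)]
    linarith
  have h₂ : ((p : ℂ) * (Complex.exp (θ * Complex.I) - 1)).re = p * (Real.cos θ - 1) := by
    rw [Complex.re_ofReal_mul, Complex.sub_re, Complex.exp_ofReal_mul_I_re, Complex.one_re]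
  rw [h₂]
  refine (mul_le_of_le_one_left (Real.exp_nonneg _) h₁).trans (Real.exp_le_exp.2 ?_)
  have h₃ := Real.cos_le_one_sub_mul_cos_sq hθ
  nlinarith

lemma tendsto_sqrt_mul_exp_div_sqrt_sub_one (z : ℂ) :
    Tendsto (fun j : ℕ => (Real.sqrt j : ℂ) * (Complex.exp (z / Real.sqrt j) - 1))
      atTop (𝓝 z) := by
  have hd : HasDerivAt (fun s : ℝ => Complex.exp (z * s)) z 0 := by
    have h := ((hasDerivAt_id (0 : ℝ)).ofReal_comp.const_mul z).cexp
    simpa using h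
  have hs : Tendsto (fun j : ℕ => (Real.sqrt j)⁻¹) atTop (𝓝[≠] 0) := by
    refine tendsto_nhdsWithin_iff.2 ⟨?_, ?_⟩
    · exact (Real.tendsto_sqrt_atTop.comp tendsto_natCast_atTop_atTop).inv_tendsto_atTop
    · filter_upwards [eventually_gt_atTop 0] with j hj
      have : 0 < Real.sqrt j := Real.sqrt_pos.2 (by exact_mod_cast hj)
      exact inv_ne_zero this.ne'
  refine (hd.tendsto_slope_zero.comp hs).congr fun j => ?_
  simp [div_eq_mul_inv]

lemma tendsto_bernoulliPoissonCharFun_pow {p : ℕ → ℝ} {q : ℝ} (hp : Tendsto p atTop (𝓝 q))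
    (u : ℝ) :
    Tendsto (fun j : ℕ => bernoulliPoissonCharFun (p j) (u / Real.sqrt j) ^ j) atTop
      (𝓝 (Real.exp (-((2 * q - q ^ 2) / 2) * u ^ 2) : ℂ)) := by
  set x : ℕ → ℂ := fun j => Complex.exp ((u * Complex.I) / Real.sqrt j) - 1 with hx
  set y : ℕ → ℂ := fun j => Complex.exp ((-(u * Complex.I)) / Real.sqrt j) - 1 with hy
  have hX := tendsto_sqrt_mul_exp_div_sqrt_sub_one (u * Complex.I)
  have hY := tendsto_sqrt_mul_exp_div_sqrt_sub_one (-(u * Complex.I))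
  have hP : Tendsto (fun j => (p j : ℂ)) atTop (𝓝 (q : ℂ)) :=
    (Complex.continuous_ofReal.tendsto q).comp hp
  have hinv : Tendsto (fun j : ℕ => ((Real.sqrt j : ℂ))⁻¹) atTop (𝓝 0) := by
    have h := (Complex.continuous_ofReal.tendsto 0).comp
      (Real.tendsto_sqrt_atTop.comp tendsto_natCast_atTop_atTop).inv_tendsto_atTop
    refine (Complex.ofReal_zero ▸ h).congr fun j => ?_
    simp
  have hsq : ∀ j : ℕ, (Real.sqrt j : ℂ) ^ 2 = j := fun j => by
    rw [← Complex.ofReal_pow, Real.sq_sqrt (Nat.cast_nonneg j), Complex.ofReal_natCast]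
  have hne : ∀ᶠ j : ℕ in atTop, (Real.sqrt j : ℂ) ≠ 0 := by
    filter_upwards [eventually_gt_atTop 0] with j hj
    have : 0 < Real.sqrt j := Real.sqrt_pos.2 (by exact_mod_cast hj)
    exact_mod_cast this.ne'
  have hx₀ : Tendsto x atTop (𝓝 0) := by
    have h := hX.mul hinv
    rw [mul_zero] at h
    refine h.congr' ?_
    filter_upwards [hne] with j hj
    rw [mul_comm, inv_mul_cancel_left₀ hj]
  have hy₀ : Tendsto y atTop (𝓝 0) := by
    have h := hY.mul hinv
    rw [mul_zero] at h
    refine h.congr' ?_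
    filter_upwards [hne] with j hj
    rw [mul_comm, inv_mul_cancel_left₀ hj]
  have hxy : ∀ j, x j + y j = -(x j * y j) := by
    intro j
    have h : Complex.exp ((u * Complex.I) / Real.sqrt j) *
        Complex.exp ((-(u * Complex.I)) / Real.sqrt j) = 1 := by
      rw [← Complex.exp_add, ← add_div, add_neg_cancel, zero_div, Complex.exp_zero]
    simp only [hx, hy]
    linear_combination h
  have hb₀ : Tendsto (fun j => (p j : ℂ) * x j) atTop (𝓝 0) := by
    simpa using hP.mul hx₀
  have hrem : Tendsto (fun j : ℕ => (j : ℂ) * (Complex.exp (p j * x j) - 1 - p j * x j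
      - (p j * x j) ^ 2 / 2)) atTop (𝓝 0) := by
    have hlim : Tendsto (fun j : ℕ => ‖((Real.sqrt j : ℂ) * x j) ^ 2 * (p j : ℂ) ^ 2 *
        (p j * x j)‖) atTop (𝓝 0) := by
      simpa using (((hX.pow 2).mul (hP.pow 2)).mul hb₀).norm
    refine squeeze_zero_norm' ?_ hlim
    have hsmall : ∀ᶠ j in atTop, ‖(p j : ℂ) * x j‖ < 1 := by
      have := hb₀.norm
      rw [norm_zero] at this
      exact this.eventually_lt_const one_pos
    filter_upwards [hsmall] with j hj
    have h := Complex.exp_bound hj.le (n := 3) (by norm_num)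
    have h' : ‖Complex.exp (p j * x j) - 1 - p j * x j - (p j * x j) ^ 2 / 2‖
        ≤ ‖(p j : ℂ) * x j‖ ^ 3 := by
      have e : Complex.exp (p j * x j) - 1 - p j * x j - (p j * x j) ^ 2 / 2 =
        Complex.exp (p j * x j) - ∑ m ∈ Finset.range 3, (p j * x j) ^ m / m.factorial := by
        simp [Finset.sum_range_succ, Nat.factorial]
        ring
      rw [e]
      refine h.trans (mul_le_of_le_one_right (by positivity) ?_)
      norm_num [Nat.factorial]
    rw [norm_mul]
    refine (mul_le_mul_of_nonneg_left h' (norm_nonneg _)).trans (le_of_eq ?_)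
    rw [← norm_pow, ← norm_mul]
    congr 1
    rw [← hsq j]
    ring
  have hmain : Tendsto (fun j : ℕ => (j : ℂ) *
      ((1 + p j * y j) * Complex.exp (p j * x j) - 1)) atTop
      (𝓝 ((-((2 * q - q ^ 2) / 2) * u ^ 2 : ℝ) : ℂ)) := by
    have h := ((hP.mul (hX.mul hY)).neg.add ((hP.pow 2).mul (hX.mul hY))).add
      (((hP.mul hy₀).const_add 1).mul ((((hP.mul hX).pow 2).div_const 2).add hrem))
    convert h using 2 with j
    · rw [← hsq j]
      change _ = -((p j : ℂ) * (Real.sqrt j * x j * (Real.sqrt j * y j))) + (p j : ℂ) ^ 2 *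
        (Real.sqrt j * x j * (Real.sqrt j * y j)) + (1 + p j * y j) *
        ((p j * (Real.sqrt j * x j)) ^ 2 / 2 + (Real.sqrt j : ℂ) ^ 2 * _)
      linear_combination (Real.sqrt j : ℂ) ^ 2 * (p j : ℂ) * hxy j
    · push_cast
      linear_combination (-(q : ℂ) * u ^ 2 + q ^ 2 * u ^ 2 / 2) * Complex.I_sq
  have h := Complex.tendsto_one_add_pow_exp_of_tendsto hmain
  rw [Complex.ofReal_exp]
  refine h.congr fun j => ?_
  rw [add_sub_cancel]
  unfold bernoulliPoissonCharFun
  simp only [hx, hy]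
  push_cast
  congr 4 <;> ring_nf

lemma tendsto_sqrt_mul_integral_bernoulliPoissonCharFun_pow {p : ℕ → ℝ} {q : ℝ}
    (hp : Tendsto p atTop (𝓝 q)) (hp₀ : ∀ j, 0 ≤ p j) (hp₁ : ∀ j, p j ≤ 1) (hq : 0 < q) :
    Tendsto (fun j : ℕ => (Real.sqrt j : ℂ) *
      ∫ θ in (-Real.pi)..Real.pi, bernoulliPoissonCharFun (p j) θ ^ j) atTop
      (𝓝 (Real.sqrt (Real.pi / ((2 * q - q ^ 2) / 2)) : ℂ)) := by
  have hlim : Tendsto (fun j : ℕ => ∫ u : ℝ,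
      (Set.Ioc (-Real.pi * Real.sqrt j) (Real.pi * Real.sqrt j)).indicator
        (fun u => bernoulliPoissonCharFun (p j) (u / Real.sqrt j) ^ j) u) atTop
      (𝓝 (∫ u : ℝ, (Real.exp (-((2 * q - q ^ 2) / 2) * u ^ 2) : ℂ))) := by
    refine MeasureTheory.tendsto_integral_filter_of_dominated_convergence
      (fun u => Real.exp (-(q / Real.pi ^ 2) * u ^ 2)) ?_ ?_ ?_ ?_
    · refine Eventually.of_forall fun j => ?_
      refine Continuous.aestronglyMeasurable ?_ |>.indicator measurableSet_Ioc
      exact ((continuous_bernoulliPoissonCharFun (p j)).comp (by fun_prop)).pow j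
    · filter_upwards [hp.eventually (eventually_ge_nhds (half_lt_self hq)),
        eventually_gt_atTop 0] with j hj hj₀
      refine Eventually.of_forall fun u => ?_
      by_cases hu : u ∈ Set.Ioc (-Real.pi * Real.sqrt j) (Real.pi * Real.sqrt j)
      · rw [Set.indicator_of_mem hu]
        have hs : 0 < Real.sqrt j := Real.sqrt_pos.2 (by exact_mod_cast hj₀)
        have hθ : |u / Real.sqrt j| ≤ Real.pi := by
          rw [abs_le]
          exact ⟨(le_div_iff₀ hs).2 hu.1.le, (div_le_iff₀ hs).2 hu.2⟩
        rw [norm_pow]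
        refine (pow_le_pow_left₀ (norm_nonneg _)
          (norm_bernoulliPoissonCharFun_le (hp₀ j) (hp₁ j) hθ) j).trans ?_
        rw [← Real.exp_nat_mul, Real.exp_le_exp, div_pow, Real.sq_sqrt (Nat.cast_nonneg j)]
        have hj' : (j : ℝ) ≠ 0 := by exact_mod_cast hj₀.ne'
        have e : (j : ℝ) * -(p j * (2 / Real.pi ^ 2 * (u ^ 2 / j)))
            = -(2 * p j * (u ^ 2 / Real.pi ^ 2)) := by
          field_simp
        have e' : -(q / Real.pi ^ 2) * u ^ 2 = -(q * (u ^ 2 / Real.pi ^ 2)) := by ring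
        rw [e, e']
        have : 0 ≤ u ^ 2 / Real.pi ^ 2 := by positivity
        nlinarith
      · rw [Set.indicator_of_notMem hu, norm_zero]
        positivity
    · exact integrable_exp_neg_mul_sq (by positivity)
    · refine Eventually.of_forall fun u => ?_
      refine (tendsto_bernoulliPoissonCharFun_pow hp u).congr' ?_
      have h := (Real.tendsto_sqrt_atTop.comp tendsto_natCast_atTop_atTop).eventually_gt_atTop
        (|u| / Real.pi)
      filter_upwards [h] with j hj
      rw [Function.comp_apply, div_lt_iff₀' Real.pi_pos] at hj
      rw [Set.indicator_of_mem]
      have := abs_lt.1 hj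
      exact ⟨by linarith, this.2.le⟩
  rw [integral_complex_ofReal, integral_gaussian] at hlim
  refine hlim.congr' ?_
  filter_upwards [eventually_gt_atTop 0] with j hj
  have hs : 0 < Real.sqrt j := Real.sqrt_pos.2 (by exact_mod_cast hj)
  rw [MeasureTheory.integral_indicator measurableSet_Ioc, ← intervalIntegral.integral_of_le
    (by nlinarith [Real.pi_pos]), intervalIntegral.integral_comp_div
    (fun θ => bernoulliPoissonCharFun (p j) θ ^ j) hs.ne', mul_div_cancel_right₀ _ hs.ne',
    mul_div_cancel_right₀ _ hs.ne', Complex.real_smul]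

/-- Local limit theorem for the probability that independent binomial `(j, p j)` and
Poisson `j * p j` variables coincide. -/
lemma tendsto_sqrt_mul_sum_binomial_mul_poisson {p : ℕ → ℝ} {q : ℝ}
    (hp : Tendsto p atTop (𝓝 q)) (hp₀ : ∀ j, 0 ≤ p j) (hp₁ : ∀ j, p j ≤ 1) (hq : 0 < q) :
    Tendsto (fun j : ℕ => Real.sqrt j * (Real.exp (-(j * p j)) *
      ∑ i ∈ Finset.range (j + 1),
        p j ^ i * (1 - p j) ^ (j - i) * j.choose i * ((j * p j) ^ i / i.factorial))) atTop
      (𝓝 (Real.sqrt (Real.pi / ((2 * q - q ^ 2) / 2)) / (2 * Real.pi))) := by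
  have h := tendsto_sqrt_mul_integral_bernoulliPoissonCharFun_pow hp hp₀ hp₁ hq
  simp only [integral_bernoulliPoissonCharFun_pow, ← Complex.ofReal_mul] at h
  have h' := ((Complex.continuous_re.tendsto _).comp h).div_const (2 * Real.pi)
  rw [Complex.ofReal_re] at h'
  refine h'.congr fun j => ?_
  rw [Function.comp_apply, Complex.ofReal_re, mul_left_comm,
    mul_div_cancel_left₀ _ Real.two_pi_pos.ne']

lemma laguerre_constant_eq {c φ : ℝ} (hφ : 0 < φ) (hc : c * (φ * (φ + 1)) = 1) :
    (c ^ 2 + 4 * c) ^ (-(1 : ℝ) / 4) * φ⁻¹ * (Real.sqrt (2 * Real.pi * c))⁻¹ =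
      Real.sqrt (Real.pi / ((2 * (1 / (1 + φ)) - (1 / (1 + φ)) ^ 2) / 2)) / (2 * Real.pi) := by
  have hc₀ : 0 < c := by
    by_contra! h
    have : 0 < φ * (φ + 1) := by positivity
    nlinarith
  have hπ := Real.pi_pos
  have h₁ : c ^ 2 + 4 * c = (c * (2 * φ + 1)) ^ 2 := by
    linear_combination (-4 * c) * hc
  have h₂ : ((c * (2 * φ + 1)) ^ 2) ^ (-(1 : ℝ) / 4) = (Real.sqrt (c * (2 * φ + 1)))⁻¹ := by
    rw [← Real.rpow_natCast, ← Real.rpow_mul (by positivity), Real.sqrt_eq_rpow,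
      ← Real.rpow_neg (by positivity)]
    norm_num
  have h₃ : c = 1 / (φ * (φ + 1)) := by
    field_simp
    linarith
  rw [h₁, h₂]
  have hv : 0 < (2 * (1 / (1 + φ)) - (1 / (1 + φ)) ^ 2) / 2 := by
    have : (2 * (1 / (1 + φ)) - (1 / (1 + φ)) ^ 2) / 2 = (2 * φ + 1) / (2 * (1 + φ) ^ 2) := by
      field_simp
      ring
    rw [this]
    positivity
  rw [← sq_eq_sq₀ (by positivity) (by positivity), mul_pow, mul_pow, inv_pow, inv_pow, inv_pow,
    div_pow, Real.sq_sqrt (by positivity), Real.sq_sqrt (by positivity),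
    Real.sq_sqrt (by positivity), h₃]
  have : (2 * (1 / (1 + φ)) - (1 / (1 + φ)) ^ 2) / 2 = (2 * φ + 1) / (2 * (1 + φ) ^ 2) := by
    field_simp
    ring
  rw [this]
  field_simp
  ring

lemma sum_eq_exp_mul_sum_binomial_mul_poisson {t k : ℝ} {j : ℕ} (hk : 0 < k)
    (htk : t * (k * (k + 1)) = j) :
    ∑ i ∈ Finset.range (j + 1), (j.choose i : ℝ) * t ^ i / (Nat.factorial i : ℝ) =
      (Real.exp (-(j * (1 / (1 + k)))) * ∑ i ∈ Finset.range (j + 1),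
        (1 / (1 + k)) ^ i * (1 - 1 / (1 + k)) ^ (j - i) * j.choose i *
          ((j * (1 / (1 + k))) ^ i / i.factorial)) *
        ((1 + 1 / k) * Real.exp (1 / (1 + k))) ^ j := by
  have hG : ((1 + 1 / k) * Real.exp (1 / (1 + k))) ^ j =
      (1 + 1 / k) ^ j * Real.exp (j * (1 / (1 + k))) := by
    rw [mul_pow, ← Real.exp_nat_mul]
  have hE : Real.exp (-(j * (1 / (1 + k)))) * Real.exp (j * (1 / (1 + k))) = 1 := by
    rw [← Real.exp_add, neg_add_cancel, Real.exp_zero]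
  rw [hG, show ∀ a b d e : ℝ, a * b * (d * e) = (a * e) * (b * d) by intros; ring, hE, one_mul,
    Finset.sum_mul]
  refine Finset.sum_congr rfl fun i hi => ?_
  have hij : i ≤ j := Nat.lt_succ_iff.1 (Finset.mem_range.1 hi)
  have h₁ : 1 - 1 / (1 + k) = (1 + 1 / k)⁻¹ := by
    field_simp
    ring
  have h₂ : (1 + 1 / k) ^ j = (1 + 1 / k) ^ (j - i) * (1 + 1 / k) ^ i := by
    rw [← pow_add, Nat.sub_add_cancel hij]
  have h₃ : (1 + 1 / k)⁻¹ ^ (j - i) * (1 + 1 / k) ^ (j - i) = 1 := by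
    rw [← mul_pow, inv_mul_cancel₀ (by positivity), one_pow]
  have h₄ : t ^ i = (1 / (1 + k)) ^ i * (j * (1 / (1 + k))) ^ i * (1 + 1 / k) ^ i := by
    rw [← mul_pow, ← mul_pow, ← htk]
    congr 1
    field_simp
    ring
  rw [h₁, h₂, h₄]
  linear_combination (-((j.choose i : ℝ) * ((1 / (1 + k)) ^ i * (j * (1 / (1 + k))) ^ i *
    (1 + 1 / k) ^ i) / i.factorial)) * h₃

/-- Asymptotics for the Laguerre polynomials `L_j(-t_j) = Σ C(j,i) t_j^i/i!` in the
regime `t_j ~ c j`. -/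
theorem laguerre_asymptotics_linear
    (c : ℝ) (hc : 0 < c)
    (t : ℕ → ℝ) (htpos : ∀ j, 0 < t j)
    (hteq : t ~[atTop] fun j : ℕ => c * (j : ℝ))
    (κ : ℕ → ℝ)
    (hκ : ∀ j : ℕ, κ j = (Real.sqrt (1 + 4 * (j : ℝ) / t j) - 1) / 2)
    (φc : ℝ) (hφc : φc = (Real.sqrt (1 + 4 / c) - 1) / 2)
    (G : ℝ → ℝ)
    (hG : ∀ z : ℝ, G z = (1 + 1 / z) * Real.exp (1 / (1 + z))) :
    (fun j : ℕ => ∑ i ∈ Finset.range (j + 1),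
        (j.choose i : ℝ) * t j ^ i / (Nat.factorial i : ℝ))
      ~[atTop] (fun j : ℕ => (c ^ 2 + 4 * c) ^ (-(1 : ℝ) / 4) * φc⁻¹ *
        (Real.sqrt (2 * Real.pi * t j))⁻¹ * (G (κ j)) ^ j) := by
  have hj₀ : ∀ᶠ j : ℕ in atTop, 0 < (j : ℝ) := by
    filter_upwards [eventually_gt_atTop 0] with j hj
    exact_mod_cast hj
  have htj : Tendsto (fun j : ℕ => t j / j) atTop (𝓝 c) := by
    have h := (isEquivalent_iff_tendsto_one (hj₀.mono fun j hj => (mul_pos hc hj).ne')).1 hteq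
    have h' := h.const_mul c
    rw [mul_one] at h'
    refine h'.congr fun j => ?_
    simp only [Pi.div_apply]
    rw [← mul_div_assoc, mul_div_mul_left _ _ hc.ne']
  have hκlim : Tendsto κ atTop (𝓝 φc) := by
    have h := (((Real.continuous_sqrt.tendsto _).comp
      ((htj.inv₀ hc.ne').const_mul 4 |>.const_add 1)).sub_const 1).div_const 2
    rw [← div_eq_mul_inv, ← hφc] at h
    refine h.congr fun j => ?_
    rw [Function.comp_apply, hκ, inv_div, mul_div_assoc]
  have hφpos : 0 < φc := by
    have : 1 < Real.sqrt (1 + 4 / c) := Real.lt_sqrt_of_sq_lt (by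
      have : 0 < 4 / c := by positivity
      linarith)
    rw [hφc]
    linarith
  have hcφ : c * (φc * (φc + 1)) = 1 := by
    have h : Real.sqrt (1 + 4 / c) ^ 2 = 1 + 4 / c := Real.sq_sqrt (by positivity)
    have e : c * (φc * (φc + 1)) = c * ((Real.sqrt (1 + 4 / c) ^ 2 - 1) / 4) := by
      rw [hφc]
      ring
    rw [e, h]
    field_simp
    ring
  have hκ₀ : ∀ j, 0 ≤ κ j := by
    intro j
    have := htpos j
    have : 1 ≤ Real.sqrt (1 + 4 * (j : ℝ) / t j) := Real.one_le_sqrt.2 (by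
      have : 0 ≤ 4 * (j : ℝ) / t j := by positivity
      linarith)
    rw [hκ]
    linarith
  have htκ : ∀ j, t j * (κ j * (κ j + 1)) = j := by
    intro j
    have ht := htpos j
    have h : Real.sqrt (1 + 4 * (j : ℝ) / t j) ^ 2 = 1 + 4 * (j : ℝ) / t j :=
      Real.sq_sqrt (by positivity)
    have e : t j * (κ j * (κ j + 1)) =
        t j * ((Real.sqrt (1 + 4 * (j : ℝ) / t j) ^ 2 - 1) / 4) := by
      rw [hκ]
      ring
    rw [e, h]
    field_simp
    ring
  have hp : Tendsto (fun j => 1 / (1 + κ j)) atTop (𝓝 (1 / (1 + φc))) :=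
    tendsto_const_nhds.div (hκlim.const_add 1) (by positivity)
  have hA := tendsto_sqrt_mul_sum_binomial_mul_poisson hp
    (fun j => by have := hκ₀ j; positivity)
    (fun j => by
      have := hκ₀ j
      rw [div_le_one (by positivity)]
      linarith) (by positivity)
  rw [← laguerre_constant_eq hφpos hcφ] at hA
  have hB : Tendsto (fun j : ℕ => Real.sqrt j * ((c ^ 2 + 4 * c) ^ (-(1 : ℝ) / 4) * φc⁻¹ *
      (Real.sqrt (2 * Real.pi * t j))⁻¹)) atTop (𝓝 ((c ^ 2 + 4 * c) ^ (-(1 : ℝ) / 4) * φc⁻¹ *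
      (Real.sqrt (2 * Real.pi * c))⁻¹)) := by
    have h := (((Real.continuous_sqrt.tendsto _).comp
      (htj.const_mul (2 * Real.pi))).inv₀ (Real.sqrt_pos.2 (by positivity)).ne').const_mul
        ((c ^ 2 + 4 * c) ^ (-(1 : ℝ) / 4) * φc⁻¹)
    refine h.congr fun j => ?_
    rw [Function.comp_apply, ← mul_div_assoc, Real.sqrt_div' _ (Nat.cast_nonneg j), inv_div]
    ring
  have hL : (c ^ 2 + 4 * c) ^ (-(1 : ℝ) / 4) * φc⁻¹ * (Real.sqrt (2 * Real.pi * c))⁻¹ ≠ 0 := by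
    have := Real.pi_pos
    positivity
  have hAB := ((isEquivalent_const_iff_tendsto hL).2 hA).trans
    ((isEquivalent_const_iff_tendsto hL).2 hB).symm
  have hfin := (IsEquivalent.refl (u := fun j : ℕ => (Real.sqrt j)⁻¹ * G (κ j) ^ j)
    (l := atTop)).mul hAB
  refine (hfin.congr_left ?_).congr_right ?_
  · filter_upwards [hj₀] with j hj
    have hs := (Real.sqrt_pos.2 hj).ne'
    have hκpos : 0 < κ j := by
      refine (hκ₀ j).lt_of_ne fun h => hj.ne ?_
      rw [← htκ j, ← h, zero_mul, mul_zero]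
    rw [sum_eq_exp_mul_sum_binomial_mul_poisson hκpos (htκ j), ← hG]
    simp only [Pi.mul_apply]
    field_simp
  · filter_upwards [hj₀] with j hj
    have hs := (Real.sqrt_pos.2 hj).ne'
    simp only [Pi.mul_apply]
    field_simp
end
end

section
/- Let ξ, ξ₁, ξ₂, … be i.i.d. almost surely positive random variables with E[ξ⁵] < ∞, and suppose that some convolution power of the distribution of ξ has a nonzero absolutely continuous component. Let 𝔪 = E[ξ] and U(t) = 1 + Σ_{n≥1} P{ξ₁+…+ξ_n ≤ t} be the renewal function (U(t)=0 for t<0). Set b₁ = E[ξ²]/(2𝔪), b₂ = −E[ξ³]/(6𝔪), b₃ = (1/24)( E[ξ⁴]/𝔪 + 2E[ξ²]E[ξ³]/𝔪² − (E[ξ²])³/𝔪³ ). Then for any sequence (t_j) with t_j→∞ and j = o(t_j^{4/5}) as j→∞, the j-fold Lebesgue–Stieltjes convolution power satisfies U^{*(j)}(t_j) ~ ( t_j^j / (𝔪^j j!) ) exp( b₁ j²/t_j + b₂ j³/t_j² + b₃ j⁴/t_j³ ) as j→∞. -/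
open MeasureTheory Filter Set Asymptotics
open scoped Topology ENNReal

noncomputable section

/-- `convPow μ j` is the `j`-fold convolution power of the measure `μ` on `ℝ`
(with `convPow μ 0` the Dirac mass at `0`). -/
def convPow (μ : Measure ℝ) : ℕ → Measure ℝ
  | 0 => Measure.dirac 0
  | n + 1 => ((convPow μ n).prod μ).map fun p => p.1 + p.2

section ConvolutionPowers

instance sFinite_convPow (μ : Measure ℝ) [SFinite μ] (n : ℕ) : SFinite (convPow μ n) := by
  induction n with
  | zero => unfold convPow; infer_instance
  | succ n ih => unfold convPow; infer_instance

instance isProbabilityMeasure_convPow (μ : Measure ℝ) [IsProbabilityMeasure μ] (n : ℕ) :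
    IsProbabilityMeasure (convPow μ n) := by
  induction n with
  | zero => unfold convPow; infer_instance
  | succ n ih =>
    unfold convPow
    exact Measure.isProbabilityMeasure_map (by fun_prop)

theorem convPow_Iio_zero {μ : Measure ℝ} [SFinite μ] (h : μ (Iio 0) = 0) (n : ℕ) :
    convPow μ n (Iio 0) = 0 := by
  induction n with
  | zero => simp [convPow]
  | succ n ih =>
    rw [convPow, Measure.map_apply (by fun_prop) measurableSet_Iio]
    refine measure_mono_null
      (t := (Iio 0 ×ˢ univ) ∪ (univ ×ˢ Iio 0)) (fun p hp => ?_) ?_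
    · simp only [mem_preimage, mem_Iio] at hp
      simp only [mem_union, mem_prod, mem_Iio, mem_univ, and_true, true_and]
      by_contra! hc
      linarith [hc.1, hc.2]
    · rw [measure_union_null_iff, Measure.prod_prod, Measure.prod_prod, ih, h]
      simp

theorem integrable_cexp_convPow {μ : Measure ℝ} [SFinite μ] {s : ℂ}
    (h : Integrable (fun x : ℝ => Complex.exp (-s * x)) μ) (n : ℕ) :
    Integrable (fun x : ℝ => Complex.exp (-s * x)) (convPow μ n) := by
  induction n with
  | zero =>
    unfold convPow
    exact integrable_dirac (by simp)
  | succ n ih =>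
    rw [convPow, integrable_map_measure (by fun_prop) (by fun_prop)]
    refine (ih.mul_prod h).congr (Eventually.of_forall fun p => ?_)
    simp [← Complex.exp_add, mul_add, add_comm]

theorem integral_cexp_convPow {μ : Measure ℝ} [SFinite μ] (s : ℂ) (n : ℕ) :
    ∫ x : ℝ, Complex.exp (-s * x) ∂(convPow μ n) =
      (∫ x : ℝ, Complex.exp (-s * x) ∂μ) ^ n := by
  induction n with
  | zero => simp [convPow]
  | succ n ih =>
    rw [convPow, integral_map (by fun_prop) (by fun_prop), pow_succ, ← ih,
      ← integral_prod_mul]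
    refine integral_congr_ae (Eventually.of_forall fun p => ?_)
    simp [← Complex.exp_add, mul_add]

theorem norm_cexp_neg_mul (s : ℂ) (x : ℝ) :
    ‖Complex.exp (-s * x)‖ = Real.exp (-s.re * x) := by
  simp [Complex.norm_exp]

theorem ae_pos_of_measure_nonpos {ρ : Measure ℝ} (hpos : ρ {x : ℝ | x ≤ 0} = 0) : ∀ᵐ x ∂ρ, 0 < x := by
  rw [ae_iff]
  simpa using hpos

theorem integrable_cexp_of_ae_pos {ρ : Measure ℝ} [IsProbabilityMeasure ρ]
    (hpos : ∀ᵐ x ∂ρ, 0 < x) {s : ℂ} (hs : 0 ≤ s.re) :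
    Integrable (fun x : ℝ => Complex.exp (-s * x)) ρ := by
  refine Integrable.of_bound (by fun_prop) 1 ?_
  filter_upwards [hpos] with x hx
  rw [norm_cexp_neg_mul]
  exact Real.exp_le_one_iff.2 (by nlinarith)

theorem integrable_rexp_of_ae_pos {ρ : Measure ℝ} [IsProbabilityMeasure ρ]
    (hpos : ∀ᵐ x ∂ρ, 0 < x) {σ : ℝ} (hs : 0 ≤ σ) :
    Integrable (fun x : ℝ => Real.exp (-σ * x)) ρ := by
  refine Integrable.of_bound (by fun_prop) 1 ?_
  filter_upwards [hpos] with x hx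
  rw [Real.norm_of_nonneg (Real.exp_pos _).le]
  exact Real.exp_le_one_iff.2 (by nlinarith)

theorem integral_rexp_lt_one {ρ : Measure ℝ} [IsProbabilityMeasure ρ]
    (hpos : ∀ᵐ x ∂ρ, 0 < x) {σ : ℝ} (hs : 0 < σ) :
    ∫ x : ℝ, Real.exp (-σ * x) ∂ρ < 1 := by
  have h1 : 0 < ∫ x : ℝ, (1 - Real.exp (-σ * x)) ∂ρ := by
    have hnn : ∀ᵐ x ∂ρ, 0 < 1 - Real.exp (-σ * x) := by
      filter_upwards [hpos] with x hx
      have : Real.exp (-σ * x) < 1 := Real.exp_lt_one_iff.mpr (by nlinarith)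
      linarith
    rw [integral_pos_iff_support_of_nonneg_ae (hnn.mono fun x hx => hx.le)
      ((integrable_const 1).sub (integrable_rexp_of_ae_pos hpos hs.le))]
    have : ρ (Function.support fun x : ℝ => 1 - Real.exp (-σ * x)) = 1 := by
      rw [← measure_univ (μ := ρ)]
      refine measure_congr ?_
      filter_upwards [hnn] with x hx
      exact propext ⟨fun _ => mem_univ x, fun _ => hx.ne'⟩
    rw [this]
    exact one_pos
  rw [integral_sub (integrable_const 1) (integrable_rexp_of_ae_pos hpos hs.le)] at h1
  simp at h1
  simpa using h1

theorem norm_integral_cexp_le {ρ : Measure ℝ} (s : ℂ) :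
    ‖∫ x : ℝ, Complex.exp (-s * x) ∂ρ‖ ≤ ∫ x : ℝ, Real.exp (-s.re * x) ∂ρ :=
  (norm_integral_le_integral_norm _).trans_eq (by simp_rw [norm_cexp_neg_mul])

theorem integral_rexp_convPow (μ : Measure ℝ) [SFinite μ] (σ : ℝ) (n : ℕ) :
    ∫ x : ℝ, Real.exp (-σ * x) ∂(convPow μ n) = (∫ x : ℝ, Real.exp (-σ * x) ∂μ) ^ n := by
  have h := integral_cexp_convPow (μ := μ) (σ : ℂ) n
  have h2 : ∀ κ : Measure ℝ, ∫ x : ℝ, Complex.exp (-(σ : ℂ) * x) ∂κ =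
      ((∫ x : ℝ, Real.exp (-σ * x) ∂κ : ℝ) : ℂ) := fun κ => by
    rw [← integral_complex_ofReal]
    simp
  rw [h2, h2] at h
  exact_mod_cast h

theorem integrable_cexp_sum_convPow {ρ : Measure ℝ} [IsProbabilityMeasure ρ]
    (hpos : ∀ᵐ x ∂ρ, 0 < x) {s : ℂ} (hs : 0 < s.re) :
    Integrable (fun x : ℝ => Complex.exp (-s * x)) (Measure.sum fun n => convPow ρ n) := by
  refine integrable_sum_measure
    (fun n => integrable_cexp_convPow (integrable_cexp_of_ae_pos hpos hs.le) n) ?_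
  simp_rw [norm_cexp_neg_mul, integral_rexp_convPow]
  exact summable_geometric_of_lt_one (integral_nonneg fun _ => (Real.exp_pos _).le)
    (integral_rexp_lt_one hpos hs)

theorem integral_cexp_sum_convPow {ρ : Measure ℝ} [IsProbabilityMeasure ρ]
    (hpos : ∀ᵐ x ∂ρ, 0 < x) {s : ℂ} (hs : 0 < s.re) :
    ∫ x : ℝ, Complex.exp (-s * x) ∂(Measure.sum fun n => convPow ρ n) =
      (1 - ∫ x : ℝ, Complex.exp (-s * x) ∂ρ)⁻¹ := by
  rw [integral_sum_measure (integrable_cexp_sum_convPow hpos hs)]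
  simp_rw [integral_cexp_convPow]
  exact tsum_geometric_of_norm_lt_one
    ((norm_integral_cexp_le s).trans_lt (integral_rexp_lt_one hpos hs))

end ConvolutionPowers

section LaplaceInversion

theorem tendsto_pow_mul_rexp_neg {σ : ℝ} (hσ : 0 < σ) (k : ℕ) :
    Tendsto (fun u : ℝ => u ^ k * Real.exp (-σ * u)) atTop (𝓝 0) := by
  have := tendsto_rpow_mul_exp_neg_mul_atTop_nhds_zero (k : ℝ) σ hσ
  simpa using this

theorem integrableOn_pow_mul_rexp_neg {σ : ℝ} (hσ : 0 < σ) (k : ℕ) :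
    IntegrableOn (fun u : ℝ => u ^ k * Real.exp (-σ * u)) (Ioi 0) := by
  have h := integrableOn_rpow_mul_exp_neg_mul_rpow (p := 1) (s := k) (b := σ)
    (lt_of_lt_of_le (by norm_num) (Nat.cast_nonneg k)) one_pos hσ
  simpa using h

theorem norm_pow_mul_cexp_neg (s : ℂ) (k : ℕ) {u : ℝ} (hu : 0 ≤ u) :
    ‖(u : ℂ) ^ k * Complex.exp (-s * u)‖ = u ^ k * Real.exp (-s.re * u) := by
  simp [Complex.norm_exp, abs_of_nonneg hu]

theorem integrableOn_pow_mul_cexp_neg {s : ℂ} (hs : 0 < s.re) (k : ℕ) :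
    IntegrableOn (fun u : ℝ => (u : ℂ) ^ k * Complex.exp (-s * u)) (Ioi 0) := by
  refine (integrableOn_pow_mul_rexp_neg hs k).mono' (by fun_prop) ?_
  filter_upwards [ae_restrict_mem measurableSet_Ioi] with u hu
  rw [norm_pow_mul_cexp_neg s k (le_of_lt hu)]

theorem integral_pow_mul_cexp_neg {s : ℂ} (hs : 0 < s.re) (k : ℕ) :
    ∫ u in Ioi (0 : ℝ), (u : ℂ) ^ k * Complex.exp (-s * u) =
      (k.factorial : ℂ) * (s ^ (k + 1))⁻¹ := by
  have hs0 : s ≠ 0 := fun h => by simp [h] at hs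
  have hlim : ∀ k : ℕ, Tendsto (fun u : ℝ => (u : ℂ) ^ k * Complex.exp (-s * u)) atTop (𝓝 0) := by
    intro k
    rw [tendsto_zero_iff_norm_tendsto_zero]
    refine (tendsto_pow_mul_rexp_neg hs k).congr' ?_
    filter_upwards [eventually_ge_atTop 0] with u hu
    rw [norm_pow_mul_cexp_neg s k hu]
  have hexp : ∀ u : ℝ, HasDerivAt (fun u : ℝ => Complex.exp (-s * u))
      (-s * Complex.exp (-s * u)) u := fun u => by
    have h := (((hasDerivAt_id u).ofReal_comp.const_mul (-s))).cexp
    simp only [id, Complex.ofReal_one, mul_one] at h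
    rw [mul_comm]
    exact h
  induction k with
  | zero =>
    have h := integral_Ioi_of_hasDerivAt_of_tendsto'
      (f := fun u : ℝ => (-s⁻¹) * ((u : ℂ) ^ 0 * Complex.exp (-s * u)))
      (f' := fun u : ℝ => (u : ℂ) ^ 0 * Complex.exp (-s * u)) (a := 0) (m := -s⁻¹ * 0)
      (fun u _ => by
        have h := (hexp u).const_mul (-s⁻¹)
        simp only [pow_zero, one_mul]
        convert! h using 1
        field_simp)
      (integrableOn_pow_mul_cexp_neg hs 0) ((hlim 0).const_mul _)
    rw [h]
    simp
  | succ k ih =>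
    have h := integral_Ioi_of_hasDerivAt_of_tendsto'
      (f := fun u : ℝ => (u : ℂ) ^ (k + 1) * Complex.exp (-s * u))
      (f' := fun u : ℝ => ((k : ℂ) + 1) * ((u : ℂ) ^ k * Complex.exp (-s * u)) -
        s * ((u : ℂ) ^ (k + 1) * Complex.exp (-s * u))) (a := 0) (m := 0)
      (fun u _ => by
        have h1 : HasDerivAt (fun u : ℝ => (u : ℂ) ^ (k + 1)) (((k : ℂ) + 1) * (u : ℂ) ^ k) u := by
          have := (hasDerivAt_id u).ofReal_comp.fun_pow (k + 1)
          simpa using this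
        convert! h1.mul (hexp u) using 1
        ring)
      (((integrableOn_pow_mul_cexp_neg hs k).const_mul _).sub
        ((integrableOn_pow_mul_cexp_neg hs (k + 1)).const_mul _)) (hlim (k + 1))
    rw [integral_sub ((integrableOn_pow_mul_cexp_neg hs k).const_mul _)
        ((integrableOn_pow_mul_cexp_neg hs (k + 1)).const_mul _), integral_const_mul,
        integral_const_mul, ih] at h
    have h' : s * ∫ u in Ioi (0 : ℝ), (u : ℂ) ^ (k + 1) * Complex.exp (-s * u) =
        ((k : ℂ) + 1) * ((k.factorial : ℂ) * (s ^ (k + 1))⁻¹) := by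
      rw [zero_sub] at h
      simp only [Complex.ofReal_zero, mul_zero, ne_eq, Nat.succ_ne_zero, not_false_eq_true,
        zero_pow, zero_mul, neg_zero] at h
      linear_combination -h
    rw [← mul_right_inj' hs0, h', Nat.factorial_succ]
    push_cast
    field_simp
    ring

theorem normSq_vertical (σ y : ℝ) : ‖(σ : ℂ) + y * Complex.I‖ ^ 2 = σ ^ 2 + y ^ 2 := by
  rw [← Complex.normSq_eq_norm_sq, Complex.normSq_add_mul_I]

theorem vertical_ne_zero {σ : ℝ} (hσ : 0 < σ) (y : ℝ) : (σ : ℂ) + y * Complex.I ≠ 0 := by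
  intro h
  have := congrArg Complex.re h
  simp at this
  exact hσ.ne' this

theorem le_norm_vertical {σ : ℝ} (y : ℝ) : σ ≤ ‖(σ : ℂ) + y * Complex.I‖ := by
  have := Complex.re_le_norm ((σ : ℂ) + y * Complex.I)
  simpa using this

theorem integrable_inv_sq_add_sq {σ : ℝ} (hσ : 0 < σ) :
    Integrable fun y : ℝ => (σ ^ 2 + y ^ 2)⁻¹ := by
  have h := ((integrable_inv_one_add_sq).comp_div hσ.ne').const_mul (σ ^ 2)⁻¹
  refine h.congr (Eventually.of_forall fun y => ?_)
  simp only
  rw [← mul_inv]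
  congr 1
  field_simp

theorem continuous_inv_vertical_pow {σ : ℝ} (hσ : 0 < σ) (k : ℕ) :
    Continuous fun y : ℝ => (((σ : ℂ) + y * Complex.I) ^ k)⁻¹ :=
  Continuous.inv₀ (by fun_prop) fun y => pow_ne_zero _ (vertical_ne_zero hσ y)

theorem integrable_inv_vertical_pow {σ : ℝ} (hσ : 0 < σ) (k : ℕ) :
    Integrable fun y : ℝ => (((σ : ℂ) + y * Complex.I) ^ (k + 2))⁻¹ := by
  refine ((integrable_inv_sq_add_sq hσ).const_mul (σ ^ k)⁻¹).mono'
    (continuous_inv_vertical_pow hσ _).aestronglyMeasurable (Eventually.of_forall fun y => ?_)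
  rw [norm_inv, norm_pow, pow_add, normSq_vertical, mul_inv]
  gcongr
  exact le_norm_vertical y

theorem integral_cexp_mul_inv_vertical_pow {σ : ℝ} (hσ : 0 < σ) (k : ℕ) (u : ℝ) :
    ∫ y : ℝ, Complex.exp (((σ : ℂ) + y * Complex.I) * u) * (((σ : ℂ) + y * Complex.I) ^ (k + 2))⁻¹ =
      2 * Real.pi * ((max u 0 ^ (k + 1) / (k + 1).factorial : ℝ) : ℂ) := by
  have hpi := Real.pi_pos
  set f : ℝ → ℂ := fun u => ((max u 0 : ℝ) : ℂ) ^ (k + 1) * Complex.exp (-(σ : ℂ) * u) with hf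
  have hfc : Continuous f := by fun_prop
  have hind : ∀ s : ℂ, (fun v : ℝ => ((max v 0 : ℝ) : ℂ) ^ (k + 1) * Complex.exp (-s * v)) =
      (Ioi (0 : ℝ)).indicator fun v : ℝ => (v : ℂ) ^ (k + 1) * Complex.exp (-s * v) := by
    intro s
    ext v
    by_cases hv : 0 < v
    · rw [indicator_of_mem (by exact hv), max_eq_left hv.le]
    · rw [indicator_of_notMem (by exact hv), max_eq_right (not_lt.1 hv)]
      simp
  have hfi : Integrable f := by
    rw [hf, hind, integrable_indicator_iff measurableSet_Ioi]
    exact integrableOn_pow_mul_cexp_neg (by simpa using hσ) _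
  have hF : ∀ w : ℝ, FourierTransform.fourier f w =
      ((k + 1).factorial : ℂ) * (((σ : ℂ) + (2 * Real.pi * w : ℝ) * Complex.I) ^ (k + 2))⁻¹ := by
    intro w
    rw [Real.fourier_real_eq_integral_exp_smul, ← integral_pow_mul_cexp_neg (by simpa using hσ),
      ← integral_indicator measurableSet_Ioi, ← hind]
    refine integral_congr_ae (Eventually.of_forall fun v => ?_)
    simp only [hf, smul_eq_mul]
    rw [mul_left_comm, ← Complex.exp_add]
    congr 2
    push_cast
    ring
  have hFi : Integrable (FourierTransform.fourier f) := by
    rw [funext hF]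
    exact ((integrable_inv_vertical_pow hσ k).comp_mul_left' (by positivity)).const_mul _
  have hinv := congrFun (hfc.fourierInv_fourier_eq hfi hFi) u
  rw [Real.fourierInv_eq'] at hinv
  simp_rw [hF] at hinv
  have hsub := Measure.integral_comp_mul_left (fun y : ℝ => Complex.exp ((y : ℂ) * u * Complex.I) *
    (((k + 1).factorial : ℂ) * (((σ : ℂ) + y * Complex.I) ^ (k + 2))⁻¹)) (2 * Real.pi)
  have h1 : ∫ y : ℝ, Complex.exp ((y : ℂ) * u * Complex.I) *
      (((k + 1).factorial : ℂ) * (((σ : ℂ) + y * Complex.I) ^ (k + 2))⁻¹) =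
      2 * Real.pi * f u := by
    rw [← hinv]
    have h2 : ∫ v : ℝ, Complex.exp (((2 * Real.pi * inner ℝ v u : ℝ) : ℂ) * Complex.I) •
      (((k + 1).factorial : ℂ) * (((σ : ℂ) + (2 * Real.pi * v : ℝ) * Complex.I) ^ (k + 2))⁻¹) =
      ∫ v : ℝ, Complex.exp (((2 * Real.pi * v : ℝ) : ℂ) * u * Complex.I) *
      (((k + 1).factorial : ℂ) * (((σ : ℂ) + (2 * Real.pi * v : ℝ) * Complex.I) ^ (k + 2))⁻¹) := by
      refine integral_congr_ae (Eventually.of_forall fun v => ?_)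
      simp only [smul_eq_mul]
      congr 2
      have : inner ℝ v u = u * v := by simp
      rw [this]
      push_cast
      ring
    rw [h2, hsub, abs_of_pos (by positivity), Complex.real_smul, ← mul_assoc]
    have : (2 * Real.pi : ℂ) * (((2 * Real.pi)⁻¹ : ℝ) : ℂ) = 1 := by
      have : (Real.pi : ℂ) ≠ 0 := by exact_mod_cast hpi.ne'
      push_cast
      field_simp
    rw [this, one_mul]
  have hfac : ((k + 1).factorial : ℂ) ≠ 0 := by exact_mod_cast (k + 1).factorial_ne_zero
  calc _ = ∫ y : ℝ, (Complex.exp (σ * u) / ((k + 1).factorial : ℂ)) *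
        (Complex.exp ((y : ℂ) * u * Complex.I) *
        (((k + 1).factorial : ℂ) * (((σ : ℂ) + y * Complex.I) ^ (k + 2))⁻¹)) := by
        refine integral_congr_ae (Eventually.of_forall fun y => ?_)
        simp only
        have : Complex.exp (((σ : ℂ) + y * Complex.I) * u) =
          Complex.exp (σ * u) * Complex.exp ((y : ℂ) * u * Complex.I) := by
          rw [← Complex.exp_add]; congr 1; ring
        rw [this]
        field_simp
    _ = _ := by
        rw [integral_const_mul, h1, hf]
        simp only
        have : Complex.exp (-(σ : ℂ) * u) = (Complex.exp (σ * u))⁻¹ := by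
          rw [← Complex.exp_neg]; congr 1; ring
        rw [this]
        have := Complex.exp_ne_zero (σ * u)
        push_cast
        field_simp

end LaplaceInversion

section Smoothing

/-- The twice integrated distribution function of `μ`. -/
def secondPrimitive (μ : Measure ℝ) (t : ℝ) : ℝ := ∫ x, max (t - x) 0 ^ 2 / 2 ∂μ

variable {μ : Measure ℝ} {σ : ℝ}

theorem integrable_secondPrimitive_kernel (hσ : 0 < σ)
    (hμ : Integrable (fun x : ℝ => Real.exp (-σ * x)) μ) (t : ℝ) :
    Integrable (fun x => max (t - x) 0 ^ 2 / 2) μ := by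
  refine (hμ.const_mul (Real.exp (σ * t) / σ ^ 2)).mono' (by fun_prop)
    (Eventually.of_forall fun x => ?_)
  rw [Real.norm_of_nonneg (by positivity)]
  have h1 := Real.quadratic_le_exp_of_nonneg (mul_nonneg hσ.le (le_max_right (t - x) 0))
  rcases le_total (t - x) 0 with h | h
  · rw [max_eq_right h]
    simp only [ne_eq, OfNat.ofNat_ne_zero, not_false_eq_true, zero_pow, zero_div]
    positivity
  · rw [max_eq_left h] at h1 ⊢
    rw [div_mul_eq_mul_div, ← Real.exp_add, le_div_iff₀ (by positivity)]
    have : σ * t + -σ * x = σ * (t - x) := by ring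
    rw [this]
    nlinarith [mul_nonneg hσ.le h]

theorem integrable_indicator_Iic (hσ : 0 < σ)
    (hμ : Integrable (fun x : ℝ => Real.exp (-σ * x)) μ) (t : ℝ) :
    Integrable ((Iic t).indicator fun _ => (1 : ℝ)) μ := by
  refine (hμ.const_mul (Real.exp (σ * t))).mono'
    ((measurable_const.indicator measurableSet_Iic).aestronglyMeasurable)
    (Eventually.of_forall fun x => ?_)
  by_cases hx : x ∈ Iic t
  · rw [indicator_of_mem hx, norm_one, ← Real.exp_add]
    refine Real.one_le_exp ?_
    have : x ≤ t := hx
    nlinarith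
  · rw [indicator_of_notMem hx, norm_zero]
    positivity

theorem sq_mul_indicator_le_kernel {h : ℝ} (hh : 0 < h) (t x : ℝ) :
    h ^ 2 * (Iic t).indicator (fun _ => (1 : ℝ)) x ≤
      max (t + 2 * h - x) 0 ^ 2 / 2 - 2 * (max (t + h - x) 0 ^ 2 / 2) + max (t - x) 0 ^ 2 / 2 := by
  by_cases hx : x ≤ t
  · rw [indicator_of_mem (by exact hx), max_eq_left (by linarith), max_eq_left (by linarith),
      max_eq_left (by linarith)]
    nlinarith
  · rw [indicator_of_notMem (by exact hx), max_eq_right (a := t - x) (by linarith)]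
    rcases le_total (t + h - x) 0 with h1 | h1
    · rw [max_eq_right h1]
      nlinarith [sq_nonneg (max (t + 2 * h - x) 0)]
    · rw [max_eq_left h1, max_eq_left (by linarith)]
      nlinarith

theorem kernel_le_sq_mul_indicator {h : ℝ} (hh : 0 < h) (t x : ℝ) :
    max (t - x) 0 ^ 2 / 2 - 2 * (max (t - h - x) 0 ^ 2 / 2) + max (t - 2 * h - x) 0 ^ 2 / 2 ≤
      h ^ 2 * (Iic t).indicator (fun _ => (1 : ℝ)) x := by
  by_cases hx : x ≤ t
  · rw [indicator_of_mem (by exact hx), max_eq_left (a := t - x) (by linarith)]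
    rcases le_total (t - h - x) 0 with h1 | h1
    · rw [max_eq_right h1, max_eq_right (by linarith)]
      nlinarith
    · rw [max_eq_left h1]
      rcases le_total (t - 2 * h - x) 0 with h2 | h2
      · rw [max_eq_right h2]
        nlinarith
      · rw [max_eq_left h2]
        nlinarith
  · rw [indicator_of_notMem (by exact hx), max_eq_right (by linarith), max_eq_right (by linarith),
      max_eq_right (by linarith)]
    simp

theorem sq_mul_measureReal_Iic_le (hσ : 0 < σ)
    (hμ : Integrable (fun x : ℝ => Real.exp (-σ * x)) μ) {h : ℝ} (hh : 0 < h) (t : ℝ) :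
    h ^ 2 * μ.real (Iic t) ≤ secondPrimitive μ (t + 2 * h) - 2 * secondPrimitive μ (t + h) +
      secondPrimitive μ t := by
  have hk := integrable_secondPrimitive_kernel hσ hμ
  have := integral_mono ((integrable_indicator_Iic hσ hμ t).const_mul (h ^ 2))
    (((hk (t + 2 * h)).sub ((hk (t + h)).const_mul 2)).add (hk t))
    (sq_mul_indicator_le_kernel hh t)
  have hI : ∫ x, (Iic t).indicator (fun _ => (1 : ℝ)) x ∂μ = μ.real (Iic t) :=
    integral_indicator_one measurableSet_Iic
  rw [integral_const_mul, hI, integral_add'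
    ((hk (t + 2 * h)).sub ((hk (t + h)).const_mul 2)) (hk t),
    integral_sub' (hk (t + 2 * h)) ((hk (t + h)).const_mul 2), integral_const_mul] at this
  exact this

theorem le_sq_mul_measureReal_Iic (hσ : 0 < σ)
    (hμ : Integrable (fun x : ℝ => Real.exp (-σ * x)) μ) {h : ℝ} (hh : 0 < h) (t : ℝ) :
    secondPrimitive μ t - 2 * secondPrimitive μ (t - h) + secondPrimitive μ (t - 2 * h) ≤
      h ^ 2 * μ.real (Iic t) := by
  have hk := integrable_secondPrimitive_kernel hσ hμ
  have := integral_mono (((hk t).sub ((hk (t - h)).const_mul 2)).add (hk (t - 2 * h)))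
    ((integrable_indicator_Iic hσ hμ t).const_mul (h ^ 2))
    (kernel_le_sq_mul_indicator hh t)
  have hI : ∫ x, (Iic t).indicator (fun _ => (1 : ℝ)) x ∂μ = μ.real (Iic t) :=
    integral_indicator_one measurableSet_Iic
  rw [integral_const_mul, hI, integral_add'
    ((hk t).sub ((hk (t - h)).const_mul 2)) (hk (t - 2 * h)),
    integral_sub' (hk t) ((hk (t - h)).const_mul 2), integral_const_mul] at this
  exact this

theorem integrable_vertical_prod [SFinite μ] (hσ : 0 < σ)
    (hμ : Integrable (fun x : ℝ => Real.exp (-σ * x)) μ) (t : ℝ) :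
    Integrable (fun p : ℝ × ℝ => Complex.exp (((σ : ℂ) + p.1 * Complex.I) * (t - p.2 : ℝ)) *
      (((σ : ℂ) + p.1 * Complex.I) ^ 3)⁻¹) (volume.prod μ) := by
  have h1 := ((integrable_inv_vertical_pow hσ 1).mul_prod (hμ.ofReal (𝕜 := ℂ))).const_mul
    ((Real.exp (σ * t) : ℝ) : ℂ)
  have hm : Measurable fun y : ℝ => (((σ : ℂ) + y * Complex.I) ^ 3)⁻¹ :=
    (continuous_inv_vertical_pow hσ 3).measurable
  refine h1.mono ?_ (Eventually.of_forall fun p => ?_)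
  · refine Measurable.aestronglyMeasurable ?_
    exact Measurable.mul (by fun_prop) (hm.comp measurable_fst)
  · have e : ‖Complex.exp (((σ : ℂ) + p.1 * Complex.I) * (t - p.2 : ℝ))‖ =
        Real.exp (σ * t) * Real.exp (-σ * p.2) := by
      rw [Complex.norm_exp, ← Real.exp_add]
      congr 1
      simp
      ring
    simp only [norm_mul, e, Complex.norm_real, Real.norm_of_nonneg (Real.exp_pos _).le,
      RCLike.norm_ofReal, Real.abs_exp]
    apply le_of_eq
    ring

theorem two_pi_mul_secondPrimitive [SFinite μ] (hσ : 0 < σ)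
    (hμ : Integrable (fun x : ℝ => Real.exp (-σ * x)) μ) (t : ℝ) :
    2 * Real.pi * (secondPrimitive μ t : ℂ) =
      ∫ y : ℝ, ∫ x : ℝ, Complex.exp (((σ : ℂ) + y * Complex.I) * (t - x : ℝ)) *
      (((σ : ℂ) + y * Complex.I) ^ 3)⁻¹ ∂μ := by
  rw [integral_integral_swap (integrable_vertical_prod hσ hμ t)]
  simp_rw [integral_cexp_mul_inv_vertical_pow hσ 1]
  rw [integral_const_mul, secondPrimitive, ← integral_complex_ofReal]
  norm_num [Nat.factorial]

theorem abs_secondPrimitive_sub_le [SFinite μ] (hσ : 0 < σ)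
    (hμ : Integrable (fun x : ℝ => Real.exp (-σ * x)) μ) {M a : ℝ} (hM : 0 ≤ M) {X : ℝ → ℂ} {j : ℕ}
    (hX : ∀ y : ℝ, ∫ x : ℝ, Complex.exp (-((σ : ℂ) + y * Complex.I) * x) ∂μ = M * X y ^ j)
    {g : ℝ → ℝ} (hg : Integrable g)
    (hXg : ∀ y : ℝ, ‖(((σ : ℂ) + y * Complex.I) ^ 3)⁻¹‖ *
      ‖X y ^ j - (σ / ((σ : ℂ) + y * Complex.I) * Complex.exp (y * a * Complex.I)) ^ j‖ ≤ g y)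
    (t : ℝ) :
    |secondPrimitive μ t - M * Real.exp (-σ * (j * a)) * σ ^ j *
      (max (t + j * a) 0 ^ (j + 2) / (j + 2).factorial)| ≤ Real.exp (σ * t) * M * ∫ y, g y := by
  have hJ := two_pi_mul_secondPrimitive hσ hμ t
  have hC := integral_cexp_mul_inv_vertical_pow hσ (j + 1) (t + j * a)
  have hi1 := (integrable_vertical_prod hσ hμ t).integral_prod_left
  have hi2 : Integrable fun y : ℝ => ((M * Real.exp (-σ * (j * a)) * σ ^ j : ℝ) : ℂ) *
      (Complex.exp (((σ : ℂ) + y * Complex.I) * (t + j * a : ℝ)) *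
        (((σ : ℂ) + y * Complex.I) ^ (j + 1 + 2))⁻¹) := by
    refine Integrable.const_mul ?_ _
    refine (integrable_inv_vertical_pow hσ (j + 1)).bdd_mul (c := Real.exp (σ * (t + j * a)))
      (by fun_prop) (Eventually.of_forall fun y => ?_)
    rw [Complex.norm_exp]
    simp
  have key : 2 * Real.pi * ((secondPrimitive μ t - M * Real.exp (-σ * (j * a)) * σ ^ j *
      (max (t + j * a) 0 ^ (j + 2) / (j + 2).factorial) : ℝ) : ℂ) =
      ∫ y : ℝ, ((Real.exp (σ * t) * M : ℝ) : ℂ) * (Complex.exp (y * t * Complex.I) *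
        ((((σ : ℂ) + y * Complex.I) ^ 3)⁻¹ *
      (X y ^ j - (σ / ((σ : ℂ) + y * Complex.I) * Complex.exp (y * a * Complex.I)) ^ j))) := by
    rw [Complex.ofReal_sub, mul_sub, hJ, Complex.ofReal_mul, mul_left_comm, ← hC,
      ← integral_const_mul, ← integral_sub hi1 hi2]
    refine integral_congr_ae (Eventually.of_forall fun y => ?_)
    simp only
    have e1 : ∫ x : ℝ, Complex.exp (((σ : ℂ) + y * Complex.I) * (t - x : ℝ)) *
        (((σ : ℂ) + y * Complex.I) ^ 3)⁻¹ ∂μ = Complex.exp (((σ : ℂ) + y * Complex.I) * t) *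
        (((σ : ℂ) + y * Complex.I) ^ 3)⁻¹ * (M * X y ^ j) := by
      rw [← hX, ← integral_const_mul]
      refine integral_congr_ae (Eventually.of_forall fun x => ?_)
      simp only
      rw [mul_right_comm, ← Complex.exp_add]
      congr 2
      push_cast
      ring
    have hs := vertical_ne_zero hσ y
    have e2 : Complex.exp (((σ : ℂ) + y * Complex.I) * t) =
        ((Real.exp (σ * t) : ℝ) : ℂ) * Complex.exp (y * t * Complex.I) := by
      rw [Complex.ofReal_exp, ← Complex.exp_add]
      congr 1
      push_cast
      ring
    have e3 : ((Real.exp (-σ * (j * a)) : ℝ) : ℂ) *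
        Complex.exp (((σ : ℂ) + y * Complex.I) * (t + j * a : ℝ)) =
        ((Real.exp (σ * t) : ℝ) : ℂ) * Complex.exp (y * t * Complex.I) *
        Complex.exp (y * a * Complex.I) ^ j := by
      rw [← Complex.exp_nat_mul, Complex.ofReal_exp, Complex.ofReal_exp, ← Complex.exp_add,
        ← Complex.exp_add, ← Complex.exp_add]
      congr 1
      push_cast
      ring
    rw [e1, e2, mul_pow, div_pow]
    have e4 : ((M * Real.exp (-σ * (j * a)) * σ ^ j : ℝ) : ℂ) *
        (Complex.exp (((σ : ℂ) + y * Complex.I) * (t + j * a : ℝ)) *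
          (((σ : ℂ) + y * Complex.I) ^ (j + 1 + 2))⁻¹) = M * σ ^ j *
          (((Real.exp (-σ * (j * a)) : ℝ) : ℂ) *
        Complex.exp (((σ : ℂ) + y * Complex.I) * (t + j * a : ℝ))) *
          (((σ : ℂ) + y * Complex.I) ^ (j + 1 + 2))⁻¹ := by
      push_cast
      ring
    rw [e4, e3, show j + 1 + 2 = j + 3 by ring, pow_add]
    push_cast
    field_simp
  have hn := norm_integral_le_of_norm_le (hg.const_mul (Real.exp (σ * t) * M))
    (f := fun y : ℝ => ((Real.exp (σ * t) * M : ℝ) : ℂ) * (Complex.exp (y * t * Complex.I) *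
        ((((σ : ℂ) + y * Complex.I) ^ 3)⁻¹ *
      (X y ^ j - (σ / ((σ : ℂ) + y * Complex.I) * Complex.exp (y * a * Complex.I)) ^ j))))
    (Eventually.of_forall fun y => by
      rw [norm_mul, norm_mul, norm_mul, Complex.norm_real,
        Real.norm_of_nonneg (by positivity), Complex.norm_exp]
      simp only [Complex.mul_re, Complex.mul_im, Complex.ofReal_re, Complex.ofReal_im,
        Complex.I_re, Complex.I_im, mul_zero, zero_mul, sub_zero, add_zero, mul_one, Real.exp_zero,
        one_mul, sub_self]
      gcongr
      exact hXg y)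
  rw [← key, norm_mul, Complex.norm_real, Real.norm_eq_abs, integral_const_mul] at hn
  refine le_trans ?_ hn
  have : (1 : ℝ) ≤ ‖(2 * Real.pi : ℂ)‖ := by
    rw [norm_mul, Complex.norm_real, Real.norm_of_nonneg Real.pi_pos.le]
    have := Real.pi_gt_three
    norm_num
    linarith
  exact le_mul_of_one_le_left (abs_nonneg _) this

end Smoothing

section TailMeasure

/-- The measure with density `u ↦ ρ (u, ∞)` on `(0, ∞)`. -/
def tailMeasure (ρ : Measure ℝ) : Measure ℝ :=
  ((ρ.prod volume).restrict {p : ℝ × ℝ | 0 < p.2 ∧ p.2 < p.1}).map Prod.snd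

variable {ρ : Measure ℝ}

theorem measurableSet_subgraph : MeasurableSet {p : ℝ × ℝ | 0 < p.2 ∧ p.2 < p.1} :=
  (measurableSet_lt measurable_const measurable_snd).inter
    (measurableSet_lt measurable_snd measurable_fst)

theorem ae_pos_tailMeasure : ∀ᵐ x ∂(tailMeasure ρ), 0 < x := by
  rw [tailMeasure, ae_map_iff (by fun_prop) measurableSet_Ioi]
  exact (ae_restrict_mem measurableSet_subgraph).mono fun p hp => hp.1

variable {E : Type*} [NormedAddCommGroup E]

theorem indicator_subgraph (f : ℝ → E) (x : ℝ) :
    (fun u => {p : ℝ × ℝ | 0 < p.2 ∧ p.2 < p.1}.indicator (fun p => f p.2) (x, u)) =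
      (Ioo 0 x).indicator f := by
  ext u
  by_cases h : u ∈ Ioo 0 x
  · rw [indicator_of_mem h, indicator_of_mem (by exact h)]
  · rw [indicator_of_notMem h, indicator_of_notMem (by exact h)]

theorem integrable_tailMeasure_iff {f : ℝ → E} (hf : StronglyMeasurable f) :
    Integrable f (tailMeasure ρ) ↔ Integrable
      ({p : ℝ × ℝ | 0 < p.2 ∧ p.2 < p.1}.indicator fun p => f p.2) (ρ.prod volume) := by
  rw [tailMeasure, integrable_map_measure hf.aestronglyMeasurable (by fun_prop),
    integrable_indicator_iff measurableSet_subgraph]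
  rfl

theorem integral_tailMeasure [SFinite ρ] [NormedSpace ℝ E] {f : ℝ → E}
    (hf : StronglyMeasurable f) (hi : Integrable f (tailMeasure ρ)) :
    ∫ x, f x ∂(tailMeasure ρ) = ∫ x, (∫ u in Ioo 0 x, f u) ∂ρ := by
  have hi' := (integrable_tailMeasure_iff hf).1 hi
  rw [tailMeasure, integral_map (by fun_prop) hf.aestronglyMeasurable,
    ← integral_indicator measurableSet_subgraph]
  refine (integral_prod _ hi').trans ?_
  refine integral_congr_ae (Eventually.of_forall fun x => ?_)
  simp only
  rw [indicator_subgraph, integral_indicator measurableSet_Ioo]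

theorem setIntegral_Ioo_pow {x : ℝ} (hx : 0 ≤ x) (k : ℕ) :
    ∫ u in Ioo 0 x, u ^ k = x ^ (k + 1) / (k + 1) := by
  rw [Measure.restrict_congr_set Ioo_ae_eq_Ioc, ← intervalIntegral.integral_of_le hx, integral_pow]
  simp

theorem integrable_pow_tailMeasure [SFinite ρ] (hpos : ∀ᵐ x ∂ρ, 0 < x) {k : ℕ}
    (h : Integrable (fun x => x ^ (k + 1)) ρ) :
    Integrable (fun x => x ^ k) (tailMeasure ρ) := by
  have hm : StronglyMeasurable fun x : ℝ => x ^ k := by fun_prop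
  have hm2 : StronglyMeasurable fun p : ℝ × ℝ => p.2 ^ k := by fun_prop
  rw [integrable_tailMeasure_iff hm, integrable_prod_iff
    (hm2.indicator measurableSet_subgraph).aestronglyMeasurable]
  constructor
  · refine Eventually.of_forall fun x => ?_
    rw [indicator_subgraph fun u => u ^ k, integrable_indicator_iff measurableSet_Ioo]
    exact ((continuous_pow k).integrableOn_Icc).mono_set Ioo_subset_Icc_self
  · refine (h.div_const ((k : ℝ) + 1)).congr ?_
    filter_upwards [hpos] with x hx
    have : (fun u => ‖{p : ℝ × ℝ | 0 < p.2 ∧ p.2 < p.1}.indicator (fun p => p.2 ^ k) (x, u)‖) =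
        (Ioo 0 x).indicator fun u => u ^ k := by
      ext u
      rw [← indicator_subgraph, Real.norm_of_nonneg]
      exact indicator_nonneg (fun p hp => pow_nonneg hp.1.le k) _
    rw [this, integral_indicator measurableSet_Ioo, setIntegral_Ioo_pow hx.le]

theorem integral_pow_tailMeasure [SFinite ρ] (hpos : ∀ᵐ x ∂ρ, 0 < x) {k : ℕ}
    (h : Integrable (fun x => x ^ (k + 1)) ρ) :
    ∫ x, x ^ k ∂(tailMeasure ρ) = (∫ x, x ^ (k + 1) ∂ρ) / (k + 1) := by
  rw [integral_tailMeasure (by fun_prop) (integrable_pow_tailMeasure hpos h), ← integral_div]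
  refine integral_congr_ae ?_
  filter_upwards [hpos] with x hx
  exact setIntegral_Ioo_pow hx.le k

theorem isFiniteMeasure_tailMeasure [SFinite ρ] (hpos : ∀ᵐ x ∂ρ, 0 < x)
    (h : Integrable (fun x => x) ρ) : IsFiniteMeasure (tailMeasure ρ) := by
  have := integrable_pow_tailMeasure (k := 0) hpos (by simpa using h)
  simp only [pow_zero] at this
  exact (integrable_const_iff_isFiniteMeasure one_ne_zero).1 this

theorem mul_integral_cexp_tailMeasure [IsProbabilityMeasure ρ] (hpos : ∀ᵐ x ∂ρ, 0 < x)
    (h : Integrable (fun x => x) ρ) {s : ℂ} (hs : 0 < s.re) :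
    s * ∫ x : ℝ, Complex.exp (-s * x) ∂(tailMeasure ρ) =
      1 - ∫ x : ℝ, Complex.exp (-s * x) ∂ρ := by
  have hs0 : s ≠ 0 := fun h0 => by simp [h0] at hs
  have := isFiniteMeasure_tailMeasure hpos h
  have hi : Integrable (fun x : ℝ => Complex.exp (-s * x)) (tailMeasure ρ) := by
    refine Integrable.of_bound (by fun_prop) 1 ?_
    filter_upwards [ae_pos_tailMeasure] with x hx
    rw [norm_cexp_neg_mul]
    exact Real.exp_le_one_iff.2 (by nlinarith)
  rw [integral_tailMeasure (Continuous.stronglyMeasurable (by fun_prop)) hi, ← integral_const_mul]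
  have e : ∫ x : ℝ, (1 : ℂ) ∂ρ = 1 := by simp
  rw [← e, ← integral_sub (integrable_const _) (integrable_cexp_of_ae_pos hpos hs.le)]
  refine integral_congr_ae ?_
  filter_upwards [hpos] with x hx
  rw [Measure.restrict_congr_set Ioo_ae_eq_Ioc, ← intervalIntegral.integral_of_le hx.le,
    integral_exp_mul_complex (neg_ne_zero.2 hs0)]
  field_simp
  simp

end TailMeasure

section VerticalLine

theorem norm_cexp_mul_I_sub_one_sub_le (θ : ℝ) :
    ‖Complex.exp (θ * Complex.I) - 1 - θ * Complex.I‖ ≤ 2 * θ ^ 2 := by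
  have hn : ‖(θ : ℂ) * Complex.I‖ = |θ| := by simp
  rcases le_total |θ| 1 with h | h
  · have := Complex.norm_exp_sub_one_sub_id_le (x := θ * Complex.I) (by rwa [hn])
    rw [hn, sq_abs] at this
    nlinarith [sq_nonneg θ]
  · have h1 : ‖Complex.exp (θ * Complex.I) - 1‖ ≤ |θ| := by
      rw [mul_comm]
      exact Real.norm_exp_I_mul_ofReal_sub_one_le
    have := norm_sub_le (Complex.exp (θ * Complex.I) - 1) (θ * Complex.I)
    rw [hn] at this
    nlinarith [sq_abs θ]

variable {τ : Measure ℝ} {σ : ℝ}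

/-- The real Laplace transform of `τ`. -/
def laplaceReal (τ : Measure ℝ) (σ : ℝ) : ℝ := ∫ x, Real.exp (-σ * x) ∂τ

/-- The mean of the exponential tilt of `τ`. -/
def tiltedMean (τ : Measure ℝ) (σ : ℝ) : ℝ := (∫ x, x * Real.exp (-σ * x) ∂τ) / laplaceReal τ σ

theorem integrable_mul_rexp_of_ae_pos (hpos : ∀ᵐ x ∂τ, 0 < x) (hσ : 0 ≤ σ) {f : ℝ → ℝ}
    (hf : Integrable f τ) : Integrable (fun x => f x * Real.exp (-σ * x)) τ := by
  refine hf.mono (hf.1.mul (by fun_prop)) ?_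
  filter_upwards [hpos] with x hx
  rw [norm_mul, Real.norm_of_nonneg (Real.exp_pos _).le]
  exact mul_le_of_le_one_right (norm_nonneg _) (Real.exp_le_one_iff.2 (by nlinarith))

theorem integrable_rexp_finite [IsFiniteMeasure τ] (hpos : ∀ᵐ x ∂τ, 0 < x) (hσ : 0 ≤ σ) :
    Integrable (fun x => Real.exp (-σ * x)) τ := by
  simpa using integrable_mul_rexp_of_ae_pos hpos hσ (integrable_const (1 : ℝ))

theorem integrable_cexp_finite [IsFiniteMeasure τ] (hpos : ∀ᵐ x ∂τ, 0 < x) {s : ℂ}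
    (hs : 0 ≤ s.re) : Integrable (fun x : ℝ => Complex.exp (-s * x)) τ := by
  refine (integrable_rexp_finite hpos hs).mono' (by fun_prop) (Eventually.of_forall fun x => ?_)
  rw [norm_cexp_neg_mul]

theorem norm_laplaceReal_sub_le [IsFiniteMeasure τ] (hpos : ∀ᵐ x ∂τ, 0 < x)
    (h2 : Integrable (fun x => x ^ 2) τ) (h1 : Integrable (fun x => x) τ) (hσ : 0 ≤ σ)
    (hL : laplaceReal τ σ ≠ 0) (y : ℝ) :
    ‖(laplaceReal τ σ : ℂ) - Complex.exp (y * tiltedMean τ σ * Complex.I) *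
      ∫ x : ℝ, Complex.exp (-((σ : ℂ) + y * Complex.I) * x) ∂τ‖ ≤
      y ^ 2 * (4 * (∫ x, x ^ 2 ∂τ) + 4 * tiltedMean τ σ ^ 2 * τ.real univ) := by
  set a := tiltedMean τ σ with ha
  have hi0 := integrable_rexp_finite hpos hσ
  have hi1 := integrable_mul_rexp_of_ae_pos hpos hσ h1
  have hic := integrable_cexp_finite (s := (σ : ℂ) + y * Complex.I) hpos (by simpa using hσ)
  have hz : ∫ x, (y * (a * Real.exp (-σ * x) - x * Real.exp (-σ * x))) ∂τ = 0 := by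
    rw [integral_const_mul, integral_sub (hi0.const_mul a) hi1, integral_const_mul,
      show a * ∫ x, Real.exp (-σ * x) ∂τ = ∫ x, x * Real.exp (-σ * x) ∂τ from div_mul_cancel₀ _ hL]
    simp
  have hzi : Integrable (fun x => y * (a * Real.exp (-σ * x) - x * Real.exp (-σ * x))) τ :=
    ((hi0.const_mul a).sub hi1).const_mul y
  have e : (laplaceReal τ σ : ℂ) - Complex.exp (y * a * Complex.I) *
      ∫ x : ℝ, Complex.exp (-((σ : ℂ) + y * Complex.I) * x) ∂τ =
      ∫ x : ℝ, -((Real.exp (-σ * x) : ℝ) : ℂ) * (Complex.exp ((y * (a - x) : ℝ) * Complex.I) - 1 -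
        (y * (a - x) : ℝ) * Complex.I) ∂τ := by
    have : (laplaceReal τ σ : ℂ) - Complex.exp (y * a * Complex.I) *
      ∫ x : ℝ, Complex.exp (-((σ : ℂ) + y * Complex.I) * x) ∂τ =
      (laplaceReal τ σ : ℂ) + ((∫ x, (y * (a * Real.exp (-σ * x) - x * Real.exp (-σ * x))) ∂τ : ℝ) : ℂ) *
        Complex.I - Complex.exp (y * a * Complex.I) *
      ∫ x : ℝ, Complex.exp (-((σ : ℂ) + y * Complex.I) * x) ∂τ := by
      rw [hz]
      simp
    have hadd : Integrable (fun x => ((Real.exp (-σ * x) : ℝ) : ℂ) +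
        ((y * (a * Real.exp (-σ * x) - x * Real.exp (-σ * x)) : ℝ) : ℂ) * Complex.I) τ :=
      hi0.ofReal.add (hzi.ofReal.mul_const _)
    rw [this, laplaceReal, ← integral_complex_ofReal, ← integral_complex_ofReal,
      ← integral_mul_const, ← integral_const_mul, ← integral_add hi0.ofReal (hzi.ofReal.mul_const _),
      ← integral_sub hadd (hic.const_mul _)]
    refine integral_congr_ae (Eventually.of_forall fun x => ?_)
    have e3 : Complex.exp (y * a * Complex.I) * Complex.exp (-((σ : ℂ) + y * Complex.I) * x) =
      ((Real.exp (-σ * x) : ℝ) : ℂ) * Complex.exp ((y * (a - x) : ℝ) * Complex.I) := by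
      rw [Complex.ofReal_exp, ← Complex.exp_add, ← Complex.exp_add]
      congr 1
      push_cast
      ring
    simp only [e3]
    push_cast
    ring
  rw [e]
  have hg : Integrable (fun x => y ^ 2 * (4 * x ^ 2 + 4 * a ^ 2)) τ :=
    ((h2.const_mul 4).add (integrable_const _)).const_mul _
  refine (norm_integral_le_of_norm_le hg ?_).trans_eq ?_
  · filter_upwards [hpos] with x hx
    rw [norm_mul, norm_neg, Complex.norm_real, Real.norm_of_nonneg (Real.exp_pos _).le]
    refine (mul_le_of_le_one_left (norm_nonneg _) (Real.exp_le_one_iff.2 (by nlinarith))).trans ?_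
    refine (norm_cexp_mul_I_sub_one_sub_le _).trans ?_
    nlinarith [mul_nonneg (sq_nonneg y) (sq_nonneg (a + x))]
  · rw [integral_const_mul, integral_add (h2.const_mul 4) (integrable_const _), integral_const_mul,
      integral_const, smul_eq_mul]
    ring

theorem laplaceReal_le [IsFiniteMeasure τ] (hpos : ∀ᵐ x ∂τ, 0 < x) (hσ : 0 ≤ σ) :
    laplaceReal τ σ ≤ τ.real univ := by
  have : ∫ x : ℝ, (1 : ℝ) ∂τ = τ.real univ := by simp
  rw [← this]
  refine integral_mono_ae (integrable_rexp_finite hpos hσ) (integrable_const _) ?_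
  filter_upwards [hpos] with x hx
  exact Real.exp_le_one_iff.2 (by nlinarith)

theorem sub_le_laplaceReal [IsFiniteMeasure τ] (hpos : ∀ᵐ x ∂τ, 0 < x)
    (h1 : Integrable (fun x => x) τ) (hσ : 0 ≤ σ) :
    τ.real univ - σ * ∫ x, x ∂τ ≤ laplaceReal τ σ := by
  have : ∫ x : ℝ, (1 - σ * x) ∂τ = τ.real univ - σ * ∫ x, x ∂τ := by
    rw [integral_sub (integrable_const _) (h1.const_mul _), integral_const_mul]
    simp
  rw [← this]
  refine integral_mono ((integrable_const _).sub (h1.const_mul _))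
    (integrable_rexp_finite hpos hσ) fun x => ?_
  have := Real.add_one_le_exp (-σ * x)
  linarith

theorem tiltedMean_nonneg (hpos : ∀ᵐ x ∂τ, 0 < x) : 0 ≤ tiltedMean τ σ := by
  refine div_nonneg (integral_nonneg_of_ae ?_) (integral_nonneg fun x => (Real.exp_pos _).le)
  filter_upwards [hpos] with x hx
  exact mul_nonneg hx.le (Real.exp_pos _).le

theorem one_add_half_le {u β : ℝ} (hu : 0 ≤ u) (h1 : 8 * β ≤ 1) (h2 : 8 * β ≤ u) :
    1 + u / 2 ≤ (1 - β) ^ 2 * (1 + u) := by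
  have h3 : 2 * β * u ≤ u / 4 := by nlinarith
  nlinarith [mul_nonneg (sq_nonneg β) hu, sq_nonneg β]

theorem exists_vertical_bounds [IsFiniteMeasure τ] (hpos : ∀ᵐ x ∂τ, 0 < x)
    (h2 : Integrable (fun x => x ^ 2) τ) (h1 : Integrable (fun x => x) τ)
    (hm : 0 < τ.real univ) :
    ∃ σ₀ > 0, ∃ δ > 0, ∃ C > 0, ∀ σ : ℝ, 0 < σ → σ ≤ σ₀ → ∀ y : ℝ, |y| ≤ δ →
      ∀ X Y : ℂ, X * (((σ : ℂ) + y * Complex.I) *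
          ∫ x : ℝ, Complex.exp (-((σ : ℂ) + y * Complex.I) * x) ∂τ) = σ * laplaceReal τ σ →
        Y = σ / ((σ : ℂ) + y * Complex.I) * Complex.exp (y * tiltedMean τ σ * Complex.I) →
        ‖X - Y‖ ≤ C * y ^ 2 ∧ ‖X‖ ^ 2 * (1 + y ^ 2 / (2 * σ ^ 2)) ≤ 1 ∧
          ‖Y‖ ^ 2 * (1 + y ^ 2 / (2 * σ ^ 2)) ≤ 1 := by
  set m := τ.real univ with hmdef
  set m1 := ∫ x, x ∂τ with hm1def
  set m2 := ∫ x, x ^ 2 ∂τ with hm2def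
  have hm1 : 0 ≤ m1 := integral_nonneg_of_ae (hpos.mono fun x hx => hx.le)
  have hm2 : 0 ≤ m2 := integral_nonneg fun x => sq_nonneg x
  set D := 4 * m2 + 4 * (2 * m1 / m) ^ 2 * m + 1 with hD
  have hDpos : 0 < D := by positivity
  set B := 2 * D / m with hB
  have hBpos : 0 < B := by positivity
  refine ⟨min (m / (2 * (m1 + 1))) (√(1 / (8 * B))), by positivity, √(1 / (8 * B)), by positivity,
    4 * D / m, by positivity, fun σ hσ hσ0 y hy X Y hX hY => ?_⟩
  have hσ1 : σ * m1 ≤ m / 2 := by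
    have := hσ0.trans (min_le_left _ _)
    rw [le_div_iff₀ (by positivity)] at this
    nlinarith
  have hσ2 : 8 * B * σ ^ 2 ≤ 1 := by
    have := Real.le_sqrt' hσ |>.1 (hσ0.trans (min_le_right _ _))
    rw [le_div_iff₀ (by positivity)] at this
    linarith
  have hy2 : 8 * B * y ^ 2 ≤ 1 := by
    have := Real.le_sqrt (abs_nonneg y) (by positivity) |>.1 hy
    rw [le_div_iff₀ (by positivity), sq_abs] at this
    linarith
  set L := laplaceReal τ σ with hLdef
  have hL : m / 2 ≤ L := by linarith [sub_le_laplaceReal hpos h1 hσ.le]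
  have hLpos : 0 < L := by linarith
  have ha0 : 0 ≤ tiltedMean τ σ := tiltedMean_nonneg hpos
  have ha : tiltedMean τ σ ≤ 2 * m1 / m := by
    have : ∫ x, x * Real.exp (-σ * x) ∂τ ≤ m1 := by
      refine integral_mono_ae (integrable_mul_rexp_of_ae_pos hpos hσ.le h1) h1 ?_
      filter_upwards [hpos] with x hx
      exact mul_le_of_le_one_right hx.le (Real.exp_le_one_iff.2 (by nlinarith))
    rw [tiltedMean, div_le_div_iff₀ hLpos hm]
    nlinarith
  set T := ∫ x : ℝ, Complex.exp (-((σ : ℂ) + y * Complex.I) * x) ∂τ with hT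
  set w := Complex.exp (y * tiltedMean τ σ * Complex.I) with hw
  have hwn : ‖w‖ = 1 := by
    rw [hw, Complex.norm_exp]
    simp
  have hmain : ‖(L : ℂ) - w * T‖ ≤ D * y ^ 2 := by
    refine (norm_laplaceReal_sub_le hpos h2 h1 hσ.le hLpos.ne' y).trans ?_
    rw [mul_comm]
    gcongr
    have : tiltedMean τ σ ^ 2 ≤ (2 * m1 / m) ^ 2 := by gcongr
    have : 4 * tiltedMean τ σ ^ 2 * m ≤ 4 * (2 * m1 / m) ^ 2 * m := by gcongr
    linarith
  have hDB : D * y ^ 2 ≤ B * y ^ 2 * L := by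
    have : D * y ^ 2 = B * y ^ 2 * (m / 2) := by
      rw [hB]
      field_simp
    rw [this]
    gcongr
  have hTn : L * (1 - B * y ^ 2) ≤ ‖T‖ := by
    have h3 := norm_sub_norm_le (L : ℂ) ((L : ℂ) - w * T)
    rw [Complex.norm_real, Real.norm_of_nonneg hLpos.le, sub_sub_cancel, norm_mul, hwn,
      one_mul] at h3
    nlinarith
  have hBy : 0 ≤ B * y ^ 2 := by positivity
  have hTpos : 0 < ‖T‖ := by nlinarith
  have hT0 : T ≠ 0 := norm_pos_iff.1 hTpos
  have hs := vertical_ne_zero hσ y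
  have hsn := normSq_vertical σ y
  set s := (σ : ℂ) + y * Complex.I with hsdef
  have hsp : 0 < ‖s‖ := norm_pos_iff.2 hs
  have hX' : X = σ / s * (L / T) := by
    rw [div_mul_div_comm, eq_div_iff (mul_ne_zero hs hT0), hX]
  have hσs : ‖(σ : ℂ) / s‖ ^ 2 * (1 + y ^ 2 / σ ^ 2) = 1 := by
    rw [norm_div, Complex.norm_real, Real.norm_of_nonneg hσ.le, div_pow, hsn]
    have : σ ^ 2 + y ^ 2 ≠ 0 := by positivity
    field_simp
  have hσs1 : ‖(σ : ℂ) / s‖ ≤ 1 := by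
    rw [norm_div, Complex.norm_real, Real.norm_of_nonneg hσ.le, div_le_one hsp]
    exact le_norm_vertical y
  have hz : y ^ 2 / (2 * σ ^ 2) = y ^ 2 / σ ^ 2 / 2 := by
    field_simp
  set u := y ^ 2 / σ ^ 2 with hu
  have hu0 : 0 ≤ u := by positivity
  have hyu : y ^ 2 = u * σ ^ 2 := by
    rw [hu]
    field_simp
  rw [hz]
  refine ⟨?_, ?_, ?_⟩
  · have : X - Y = σ / s * (((L : ℂ) - w * T) / T) := by
      rw [hX', hY]
      field_simp
    rw [this, norm_mul, norm_div _ T]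
    refine (mul_le_of_le_one_left (by positivity) hσs1).trans ?_
    rw [div_le_iff₀ hTpos]
    refine hmain.trans ?_
    have : m / 4 ≤ ‖T‖ := by nlinarith
    calc D * y ^ 2 = 4 * D / m * y ^ 2 * (m / 4) := by field_simp
      _ ≤ _ := by gcongr
  · rw [hX', norm_mul, mul_pow, norm_div (L : ℂ) T, Complex.norm_real,
      Real.norm_of_nonneg hLpos.le]
    have hLT : (L / ‖T‖) ^ 2 * (1 - B * y ^ 2) ^ 2 ≤ 1 := by
      rw [← mul_pow, div_mul_eq_mul_div]
      refine pow_le_one₀ (div_nonneg (mul_nonneg hLpos.le (by linarith)) hTpos.le) ?_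
      rw [div_le_one hTpos]
      exact hTn
    have hq : 1 + u / 2 ≤ (1 - B * y ^ 2) ^ 2 * (1 + u) := by
      refine one_add_half_le hu0 (by linarith) ?_
      rw [hyu]
      calc 8 * (B * (u * σ ^ 2)) = 8 * B * σ ^ 2 * u := by ring
        _ ≤ 1 * u := by gcongr
        _ = u := one_mul u
    calc ‖(σ : ℂ) / s‖ ^ 2 * (L / ‖T‖) ^ 2 * (1 + u / 2)
        ≤ ‖(σ : ℂ) / s‖ ^ 2 * (L / ‖T‖) ^ 2 * ((1 - B * y ^ 2) ^ 2 * (1 + u)) := by gcongr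
      _ = (‖(σ : ℂ) / s‖ ^ 2 * (1 + u)) * ((L / ‖T‖) ^ 2 * (1 - B * y ^ 2) ^ 2) := by ring
      _ ≤ 1 := by rw [hσs, one_mul]; exact hLT
  · rw [hY, norm_mul, hwn, mul_one, ← hσs]
    exact mul_le_mul_of_nonneg_left (by linarith) (sq_nonneg _)

end VerticalLine

section PowerDifference

theorem norm_pow_sub_pow_le_mul {X Y : ℂ} {r : ℝ} (hX : ‖X‖ ≤ r) (hY : ‖Y‖ ≤ r) (n : ℕ) :
    ‖X ^ (n + 1) - Y ^ (n + 1)‖ ≤ (n + 1) * ‖X - Y‖ * r ^ n := by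
  have hr : 0 ≤ r := (norm_nonneg X).trans hX
  induction n with
  | zero => simp
  | succ n ih =>
    have e : X ^ (n + 1 + 1) - Y ^ (n + 1 + 1) =
        X * (X ^ (n + 1) - Y ^ (n + 1)) + (X - Y) * Y ^ (n + 1) := by ring
    rw [e]
    calc _ ≤ ‖X‖ * ‖X ^ (n + 1) - Y ^ (n + 1)‖ + ‖X - Y‖ * ‖Y‖ ^ (n + 1) := by
          refine (norm_add_le _ _).trans_eq ?_
          rw [norm_mul, norm_mul, norm_pow Y]
      _ ≤ r * ((n + 1) * ‖X - Y‖ * r ^ n) + ‖X - Y‖ * r ^ (n + 1) := by gcongr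
      _ = _ := by
          push_cast
          ring

theorem norm_pow_sub_pow_le_div {X Y : ℂ} {z D : ℝ} {n q : ℕ} (hz : 0 ≤ z) (hq : 1 ≤ q)
    (hn : 4 * q ≤ n) (hX : ‖X‖ ^ 2 * (1 + z) ≤ 1) (hY : ‖Y‖ ^ 2 * (1 + z) ≤ 1)
    (hD : 0 ≤ D) (hXY : ‖X - Y‖ ≤ D * z) :
    ‖X ^ (n + 1) - Y ^ (n + 1)‖ ≤ (n + 1) * D / q * (1 + q * z)⁻¹ := by
  have h1z : 0 < 1 + z := by linarith
  have hle : ∀ Z : ℂ, ‖Z‖ ^ 2 * (1 + z) ≤ 1 → ‖Z‖ ≤ √(1 + z)⁻¹ := fun Z hZ => by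
    refine Real.le_sqrt_of_sq_le ?_
    rwa [← one_div, le_div_iff₀ h1z]
  have hr1 : √(1 + z)⁻¹ ≤ 1 := by
    rw [Real.sqrt_le_one]
    exact inv_le_one_of_one_le₀ (by linarith)
  have hq0 : (0 : ℝ) < q := by exact_mod_cast hq
  have hqz : 0 < 1 + q * z := by positivity
  have hr : √(1 + z)⁻¹ ^ n ≤ ((1 + q * z)⁻¹) ^ 2 := by
    refine (pow_le_pow_of_le_one (Real.sqrt_nonneg _) hr1 hn).trans ?_
    rw [show 4 * q = 2 * (q * 2) by ring, pow_mul, Real.sq_sqrt (by positivity), pow_mul, inv_pow]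
    gcongr
    exact one_add_mul_le_pow (by linarith) q
  calc _ ≤ (n + 1) * ‖X - Y‖ * √(1 + z)⁻¹ ^ n := norm_pow_sub_pow_le_mul (hle X hX) (hle Y hY) n
    _ ≤ (n + 1) * (D * z) * ((1 + q * z)⁻¹) ^ 2 := by
        have := (norm_nonneg _).trans hXY
        gcongr
    _ = (n + 1) * (D * z) * (1 + q * z)⁻¹ * (1 + q * z)⁻¹ := by ring
    _ ≤ _ := by
        gcongr
        rw [← div_eq_mul_inv, div_le_div_iff₀ hqz hq0]
        have : 0 ≤ (n + 1) * D := by positivity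
        linarith

theorem integrable_inv_one_add_mul_sq {c : ℝ} (hc : 0 < c) :
    Integrable fun y : ℝ => (1 + (c * y) ^ 2)⁻¹ :=
  integrable_inv_one_add_sq.comp_mul_left' hc.ne'

theorem integral_inv_one_add_mul_sq {c : ℝ} (hc : 0 < c) :
    ∫ y : ℝ, (1 + (c * y) ^ 2)⁻¹ = c⁻¹ * Real.pi := by
  rw [Measure.integral_comp_mul_left (fun y : ℝ => (1 + y ^ 2)⁻¹) c,
    integral_univ_inv_one_add_sq, abs_of_pos (inv_pos.2 hc), smul_eq_mul]

theorem exists_dominating_function {δ C σ : ℝ} (hδ : 0 < δ) (hC : 0 ≤ C) (hσ : 0 < σ)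
    {X Y : ℝ → ℂ} (hX : ∀ y, ‖X y‖ ≤ 1) (hY : ∀ y, ‖Y y‖ ≤ 1)
    (hXY : ∀ y, |y| ≤ δ → ‖X y - Y y‖ ≤ C * y ^ 2 ∧ ‖X y‖ ^ 2 * (1 + y ^ 2 / (2 * σ ^ 2)) ≤ 1 ∧
      ‖Y y‖ ^ 2 * (1 + y ^ 2 / (2 * σ ^ 2)) ≤ 1) {j : ℕ} (hj : 5 ≤ j) :
    ∃ g : ℝ → ℝ, Integrable g ∧
      (∀ y : ℝ, ‖(((σ : ℂ) + y * Complex.I) ^ 3)⁻¹‖ * ‖X y ^ j - Y y ^ j‖ ≤ g y) ∧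
      ∫ y, g y ≤ 32 * Real.pi * C + 2 * (1 + δ ^ 2) / δ ^ 3 * Real.pi := by
  obtain ⟨n, rfl⟩ : ∃ n, j = n + 1 := ⟨j - 1, by omega⟩
  obtain ⟨q, hq, hqn, hnq⟩ : ∃ q : ℕ, 1 ≤ q ∧ 4 * q ≤ n ∧ n + 1 ≤ 8 * q :=
    ⟨n / 4, by omega, by omega, by omega⟩
  have hq1 : (1 : ℝ) ≤ q := by exact_mod_cast hq
  have hq0 : (0 : ℝ) < q := by linarith
  have hnq' : (n : ℝ) + 1 ≤ 8 * q := by exact_mod_cast hnq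
  set c := √(q / 2) / σ with hc
  have hc0 : 0 < c := by positivity
  have hcy : ∀ y, (c * y) ^ 2 = q * (y ^ 2 / (2 * σ ^ 2)) := fun y => by
    rw [hc, mul_pow, div_pow, Real.sq_sqrt (by positivity)]
    field_simp
  set A := (n + 1) * (2 * C) / (q * σ) with hA
  set B := 2 * (1 + δ ^ 2) / δ ^ 3 with hB
  have hA0 : 0 ≤ A := by positivity
  have hB0 : 0 ≤ B := by positivity
  have hi1 := (integrable_inv_one_add_mul_sq hc0).const_mul A
  have hi2 := integrable_inv_one_add_sq.const_mul B
  refine ⟨fun y => A * (1 + (c * y) ^ 2)⁻¹ + B * (1 + y ^ 2)⁻¹, hi1.add hi2, fun y => ?_, ?_⟩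
  · have hsn := normSq_vertical σ y
    have hσs := le_norm_vertical (σ := σ) y
    rw [norm_inv, norm_pow]
    set s := ‖(σ : ℂ) + y * Complex.I‖
    have hs0 : 0 < s := hσ.trans_le hσs
    rcases le_or_gt |y| δ with hy | hy
    · obtain ⟨h1, h2, h3⟩ := hXY y hy
      have h4 := norm_pow_sub_pow_le_div (D := 2 * C * σ ^ 2) (by positivity) hq hqn h2 h3
        (by positivity) (h1.trans_eq (by field_simp))
      rw [← hcy] at h4
      refine le_trans ?_ (le_add_of_nonneg_right (by positivity))
      calc (s ^ 3)⁻¹ * ‖X y ^ (n + 1) - Y y ^ (n + 1)‖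
          ≤ (σ ^ 3)⁻¹ * ((n + 1) * (2 * C * σ ^ 2) / q * (1 + (c * y) ^ 2)⁻¹) := by gcongr
        _ = A * (1 + (c * y) ^ 2)⁻¹ := by
          rw [hA]
          field_simp
    · refine le_trans ?_ (le_add_of_nonneg_left (by positivity))
      have h2 : ‖X y ^ (n + 1) - Y y ^ (n + 1)‖ ≤ 2 := by
        refine (norm_sub_le _ _).trans ?_
        rw [norm_pow, norm_pow]
        linarith [pow_le_one₀ (norm_nonneg _) (hX y) (n := n + 1),
          pow_le_one₀ (norm_nonneg _) (hY y) (n := n + 1)]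
      have hys : |y| ≤ s := abs_le_of_sq_le_sq (by nlinarith) hs0.le
      have hds : δ ≤ s := hy.le.trans hys
      have hs2 : y ^ 2 ≤ s ^ 2 := by rw [hsn]; nlinarith
      have hd2 : δ ^ 2 ≤ s ^ 2 := by gcongr
      calc (s ^ 3)⁻¹ * ‖X y ^ (n + 1) - Y y ^ (n + 1)‖ ≤ (s ^ 3)⁻¹ * 2 := by gcongr
        _ ≤ B * (1 + y ^ 2)⁻¹ := by
          rw [hB, ← div_eq_inv_mul, ← div_eq_mul_inv, div_div, div_le_div_iff₀ (by positivity)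
            (by positivity)]
          have h3 : δ ^ 3 * (1 + y ^ 2) ≤ δ * (s ^ 2 * (1 + δ ^ 2)) := by
            have : δ ^ 2 * (1 + y ^ 2) ≤ s ^ 2 * (1 + δ ^ 2) := by nlinarith [sq_nonneg δ]
            nlinarith
          have h4 : δ * (s ^ 2 * (1 + δ ^ 2)) ≤ s * (s ^ 2 * (1 + δ ^ 2)) := by gcongr
          nlinarith
  · rw [integral_add hi1 hi2, integral_const_mul, integral_const_mul,
      integral_inv_one_add_mul_sq hc0, integral_univ_inv_one_add_sq]
    refine add_le_add_left ?_ _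
    have h2 : 1 / 2 ≤ √((q : ℝ) / 2) := Real.le_sqrt_of_sq_le (by linarith)
    have e : A * (c⁻¹ * Real.pi) = (n + 1) / q * (2 * C) * Real.pi / √(q / 2) := by
      rw [hA, hc]
      field_simp
    rw [e, div_le_iff₀ (by positivity)]
    have h3 : ((n : ℝ) + 1) / q ≤ 8 := by rwa [div_le_iff₀ hq0]
    calc (n + 1) / q * (2 * C) * Real.pi ≤ 8 * (2 * C) * Real.pi := by gcongr
      _ = 32 * Real.pi * C * (1 / 2) := by ring
      _ ≤ _ := by gcongr

end PowerDifference

section RenewalMeasure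

variable {ρ : Measure ℝ} [IsProbabilityMeasure ρ]

theorem integral_id_pos (hpos : ∀ᵐ x ∂ρ, 0 < x) (h1 : Integrable (fun x => x) ρ) :
    0 < ∫ x, x ∂ρ := by
  rw [integral_pos_iff_support_of_nonneg_ae (hpos.mono fun x hx => hx.le) h1]
  have hs : ∀ᵐ x ∂ρ, x ∈ Function.support fun x : ℝ => x := hpos.mono fun x hx => hx.ne'
  have hu : ρ (Function.support fun x : ℝ => x) = ρ univ := measure_congr (eventuallyEq_univ.2 hs)
  rw [hu]
  simp

theorem laplaceReal_tailMeasure (hpos : ∀ᵐ x ∂ρ, 0 < x) (h1 : Integrable (fun x => x) ρ) {σ : ℝ}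
    (hσ : 0 < σ) : σ * laplaceReal (tailMeasure ρ) σ = 1 - ∫ x : ℝ, Real.exp (-σ * x) ∂ρ := by
  have h := mul_integral_cexp_tailMeasure hpos h1 (s := (σ : ℂ)) (by simpa using hσ)
  have e : ∀ κ : Measure ℝ, ∫ x : ℝ, Complex.exp (-(σ : ℂ) * x) ∂κ =
      ((∫ x : ℝ, Real.exp (-σ * x) ∂κ : ℝ) : ℂ) := fun κ => by
    rw [← integral_complex_ofReal]
    simp
  rw [e, e] at h
  exact_mod_cast h

theorem exists_secondPrimitive_bound (hpos : ∀ᵐ x ∂ρ, 0 < x) (h1 : Integrable (fun x => x) ρ)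
    (h2 : Integrable (fun x => x ^ 2) ρ) (h3 : Integrable (fun x => x ^ 3) ρ) :
    ∃ σ₀ > 0, ∃ K > 0, ∀ σ : ℝ, 0 < σ → σ ≤ σ₀ → ∀ j : ℕ, 5 ≤ j → ∀ t : ℝ,
      |secondPrimitive (convPow (Measure.sum fun n => convPow ρ n) j) t -
        (laplaceReal (tailMeasure ρ) σ ^ j)⁻¹ *
          Real.exp (-σ * (j * tiltedMean (tailMeasure ρ) σ)) *
          (max (t + j * tiltedMean (tailMeasure ρ) σ) 0 ^ (j + 2) / (j + 2).factorial)| ≤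
        K * Real.exp (σ * t) * ((σ * laplaceReal (tailMeasure ρ) σ) ^ j)⁻¹ := by
  have hfin := isFiniteMeasure_tailMeasure hpos h1
  have hm0 : 0 < (tailMeasure ρ).real univ := by
    have e : (tailMeasure ρ).real univ = ∫ x, x ∂ρ := by
      simpa using integral_pow_tailMeasure (k := 0) hpos (by simpa using h1)
    rw [e]
    exact integral_id_pos hpos h1
  obtain ⟨σ₀, hσ₀, δ, hδ, C, hC, hb⟩ := exists_vertical_bounds ae_pos_tailMeasure
    (integrable_pow_tailMeasure (k := 2) hpos h3)
    (by simpa using integrable_pow_tailMeasure (k := 1) hpos h2) hm0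
  refine ⟨σ₀, hσ₀, 32 * Real.pi * C + 2 * (1 + δ ^ 2) / δ ^ 3 * Real.pi, by positivity,
    fun σ hσ hσ1 j hj t => ?_⟩
  set τ := tailMeasure ρ with hτ
  set L := laplaceReal τ σ with hL
  set a := tiltedMean τ σ with ha
  have hσL : σ * L = 1 - ∫ x : ℝ, Real.exp (-σ * x) ∂ρ := laplaceReal_tailMeasure hpos h1 hσ
  have hσLpos : 0 < σ * L := by
    rw [hσL]
    linarith [integral_rexp_lt_one hpos hσ]
  have hre : ∀ y : ℝ, ((σ : ℂ) + y * Complex.I).re = σ := fun y => by simp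
  set T : ℝ → ℂ := fun y => ∫ x : ℝ, Complex.exp (-((σ : ℂ) + y * Complex.I) * x) ∂τ with hT
  have hsT : ∀ y : ℝ, ((σ : ℂ) + y * Complex.I) * T y =
      1 - ∫ x : ℝ, Complex.exp (-((σ : ℂ) + y * Complex.I) * x) ∂ρ := fun y =>
    mul_integral_cexp_tailMeasure hpos h1 (by rwa [hre])
  have hsTn : ∀ y : ℝ, σ * L ≤ ‖((σ : ℂ) + y * Complex.I) * T y‖ := fun y => by
    rw [hsT, hσL]
    have h4 := norm_integral_cexp_le (ρ := ρ) ((σ : ℂ) + y * Complex.I)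
    rw [hre] at h4
    have h5 := norm_sub_norm_le (1 : ℂ) (∫ x : ℝ, Complex.exp (-((σ : ℂ) + y * Complex.I) * x) ∂ρ)
    rw [norm_one] at h5
    linarith
  have hsT0 : ∀ y : ℝ, ((σ : ℂ) + y * Complex.I) * T y ≠ 0 := fun y =>
    norm_pos_iff.1 (hσLpos.trans_le (hsTn y))
  set X : ℝ → ℂ := fun y => (σ * L : ℝ) / (((σ : ℂ) + y * Complex.I) * T y) with hX
  set Y : ℝ → ℂ := fun y => σ / ((σ : ℂ) + y * Complex.I) * Complex.exp (y * a * Complex.I) with hY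
  obtain ⟨g, hg, hXg, hgK⟩ := exists_dominating_function (X := X) (Y := Y) hδ hC.le hσ
    (fun y => by
      rw [hX]
      simp only
      rw [norm_div, Complex.norm_real, Real.norm_of_nonneg hσLpos.le,
        div_le_one (hσLpos.trans_le (hsTn y))]
      exact hsTn y)
    (fun y => by
      have e : ‖Complex.exp (y * a * Complex.I)‖ = 1 := by
        rw [Complex.norm_exp]
        simp
      rw [hY]
      simp only
      rw [norm_mul, e, mul_one, norm_div, Complex.norm_real, Real.norm_of_nonneg hσ.le,
        div_le_one (norm_pos_iff.2 (vertical_ne_zero hσ y))]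
      exact le_norm_vertical y)
    (fun y hy => hb σ hσ hσ1 y hy (X y) (Y y)
      (by
        rw [hX]
        simp only
        rw [div_mul_cancel₀ _ (hsT0 y)]
        push_cast
        rfl) rfl) hj
  have hν : Integrable (fun x : ℝ => Complex.exp (-(σ : ℂ) * x))
      (Measure.sum fun n => convPow ρ n) := integrable_cexp_sum_convPow hpos (by simpa using hσ)
  have hμ : Integrable (fun x : ℝ => Real.exp (-σ * x))
      (convPow (Measure.sum fun n => convPow ρ n) j) := by
    refine (integrable_cexp_convPow hν j).norm.congr (Eventually.of_forall fun x => ?_)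
    simp only
    rw [norm_cexp_neg_mul, Complex.ofReal_re]
  have key := abs_secondPrimitive_sub_le hσ hμ (M := ((σ * L) ^ j)⁻¹) (a := a) (X := X) (j := j)
    (by positivity) (fun y => by
      rw [integral_cexp_convPow, integral_cexp_sum_convPow hpos (by rwa [hre]), ← hsT, hX]
      simp only
      have h6 : ((σ * L : ℝ) : ℂ) ≠ 0 := Complex.ofReal_ne_zero.2 hσLpos.ne'
      have h7 := hsT0 y
      rw [div_pow, inv_pow, Complex.ofReal_inv, Complex.ofReal_pow]
      field_simp) hg hXg t
  have e1 : ((σ * L) ^ j)⁻¹ * Real.exp (-σ * (j * a)) * σ ^ j =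
      (L ^ j)⁻¹ * Real.exp (-σ * (j * a)) := by
    have hL0 : L ≠ 0 := (pos_of_mul_pos_right hσLpos hσ.le).ne'
    rw [mul_pow]
    field_simp
  rw [e1] at key
  refine key.trans ?_
  calc _ ≤ Real.exp (σ * t) * ((σ * L) ^ j)⁻¹ *
        (32 * Real.pi * C + 2 * (1 + δ ^ 2) / δ ^ 3 * Real.pi) := by gcongr
    _ = _ := by ring

end RenewalMeasure

section SecondDifference

theorem hasDerivAt_pow_div_factorial (n : ℕ) (x : ℝ) :
    HasDerivAt (fun x : ℝ => x ^ (n + 1) / (n + 1).factorial) (x ^ n / n.factorial) x := by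
  refine ((hasDerivAt_pow (n + 1) x).div_const _).congr_deriv ?_
  rw [Nat.factorial_succ]
  push_cast
  have : (n.factorial : ℝ) ≠ 0 := by positivity
  have : (n : ℝ) + 1 ≠ 0 := by positivity
  field_simp

theorem pow_div_factorial_sub_bounds {x h : ℝ} (hx : 0 ≤ x) (hh : 0 < h) (n : ℕ) :
    h * (x ^ n / n.factorial) ≤
        (x + h) ^ (n + 1) / (n + 1).factorial - x ^ (n + 1) / (n + 1).factorial ∧
      (x + h) ^ (n + 1) / (n + 1).factorial - x ^ (n + 1) / (n + 1).factorial ≤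
        h * ((x + h) ^ n / n.factorial) := by
  obtain ⟨c, hc, he⟩ := exists_hasDerivAt_eq_slope (fun x : ℝ => x ^ (n + 1) / (n + 1).factorial)
    (fun x => x ^ n / n.factorial) (by linarith : x < x + h) (by fun_prop)
    fun c _ => hasDerivAt_pow_div_factorial n c
  have hc0 : 0 ≤ c := hx.trans hc.1.le
  rw [add_sub_cancel_left, eq_div_iff hh.ne', mul_comm] at he
  rw [← he]
  constructor
  · gcongr
    exact hc.1.le
  · gcongr
    exact hc.2.le

theorem second_difference_pow_bounds {x h : ℝ} (hx : 0 ≤ x) (hh : 0 < h) (n : ℕ) :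
    h ^ 2 * (x ^ n / n.factorial) ≤ (x + 2 * h) ^ (n + 2) / (n + 2).factorial -
        2 * ((x + h) ^ (n + 2) / (n + 2).factorial) + x ^ (n + 2) / (n + 2).factorial ∧
      (x + 2 * h) ^ (n + 2) / (n + 2).factorial -
        2 * ((x + h) ^ (n + 2) / (n + 2).factorial) + x ^ (n + 2) / (n + 2).factorial ≤
        h ^ 2 * ((x + 2 * h) ^ n / n.factorial) := by
  obtain ⟨c, hc, he⟩ := exists_hasDerivAt_eq_slope
    (fun x : ℝ => (x + h) ^ (n + 2) / (n + 2).factorial - x ^ (n + 2) / (n + 2).factorial)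
    (fun x => (x + h) ^ (n + 1) / (n + 1).factorial - x ^ (n + 1) / (n + 1).factorial)
    (by linarith : x < x + h) (by fun_prop)
    fun c _ => ((hasDerivAt_pow_div_factorial (n + 1) (c + h)).comp_add_const c h).sub
      (hasDerivAt_pow_div_factorial (n + 1) c)
  have hc0 : 0 ≤ c := hx.trans hc.1.le
  obtain ⟨h1, h2⟩ := pow_div_factorial_sub_bounds hc0 hh n
  rw [add_sub_cancel_left, eq_div_iff hh.ne', mul_comm] at he
  have e : (x + 2 * h) ^ (n + 2) / (n + 2).factorial -
        2 * ((x + h) ^ (n + 2) / (n + 2).factorial) + x ^ (n + 2) / (n + 2).factorial =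
      h * ((c + h) ^ (n + 1) / (n + 1).factorial - c ^ (n + 1) / (n + 1).factorial) := by
    rw [he, show x + 2 * h = x + h + h by ring]
    ring
  rw [e, pow_two, mul_assoc, mul_assoc]
  constructor
  · gcongr
    refine le_trans ?_ h1
    gcongr
    exact hc.1.le
  · gcongr
    refine h2.trans ?_
    have : c + h ≤ x + 2 * h := by linarith [hc.2]
    gcongr

theorem add_pow_le_mul_exp {A u : ℝ} (hA : 0 < A) (hu : 0 ≤ u) (j : ℕ) :
    (A + u) ^ j ≤ A ^ j * Real.exp (j * (u / A)) := by
  rw [Real.exp_nat_mul, ← mul_pow]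
  gcongr
  have := Real.add_one_le_exp (u / A)
  calc A + u = A * (u / A + 1) := by
        field_simp
        ring
    _ ≤ _ := by gcongr

theorem mul_exp_le_sub_pow {A u : ℝ} (hA : 0 < A) (hu : 0 ≤ u) (huA : 2 * u ≤ A) (j : ℕ) :
    A ^ j * Real.exp (-(j * (2 * (u / A)))) ≤ (A - u) ^ j := by
  rw [← mul_neg, Real.exp_nat_mul, ← mul_pow]
  gcongr
  set x := u / A with hx
  have hx0 : 0 ≤ x := by positivity
  have hx1 : x ≤ 1 / 2 := by
    rw [hx, div_le_iff₀ hA]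
    linarith
  have e : A - u = A * (1 - x) := by
    rw [hx]
    field_simp
  rw [e, Real.exp_neg]
  gcongr
  rw [inv_le_comm₀ (Real.exp_pos _) (by linarith)]
  refine le_trans ?_ (Real.add_one_le_exp _)
  rw [inv_le_iff_one_le_mul₀ (by linarith)]
  nlinarith

theorem measureReal_Iic_bounds {μ : Measure ℝ} {σ : ℝ} (hσ : 0 < σ)
    (hμ : Integrable (fun x : ℝ => Real.exp (-σ * x)) μ) {N P B : ℝ} (hN : 0 < N) (hP : 0 ≤ P)
    {j : ℕ} (hJ : ∀ t, |secondPrimitive μ t - N * (max (t + B) 0 ^ (j + 2) / (j + 2).factorial)| ≤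
      P * Real.exp (σ * t)) {t δ : ℝ} (hδ : 0 < δ) (hδA : 4 * δ ≤ σ * (t + B))
    (hjA : (j : ℝ) ≤ 2 * (σ * (t + B))) :
    μ.real (Iic t) ≤ N * ((t + B) ^ j / j.factorial) * Real.exp (4 * δ) +
        4 * P * Real.exp (2 * δ) / δ ^ 2 * (σ ^ 2 * Real.exp (σ * t)) ∧
      N * ((t + B) ^ j / j.factorial) * Real.exp (-(8 * δ)) -
        4 * P * Real.exp (2 * δ) / δ ^ 2 * (σ ^ 2 * Real.exp (σ * t)) ≤ μ.real (Iic t) := by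
  set A := t + B with hA
  have hA0 : 0 < A := by
    by_contra hneg
    nlinarith
  set h := δ / σ with hh
  have hh0 : 0 < h := by positivity
  have hσh : σ * h = δ := by
    rw [hh]
    field_simp
  have h4A : 4 * h ≤ A := by
    have : 4 * (σ * h) ≤ σ * A := by rwa [hσh]
    nlinarith
  have hjh : j * (2 * h / A) ≤ 4 * δ := by
    rw [← mul_div_assoc, div_le_iff₀ hA0, ← hσh]
    nlinarith
  have hexp : ∀ u, u ≤ 2 * h → Real.exp (σ * (t + u)) ≤ Real.exp (2 * δ) * Real.exp (σ * t) :=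
    fun u hu => by
      rw [← Real.exp_add]
      refine Real.exp_le_exp.2 ?_
      nlinarith
  have hJ' : ∀ u, u ≤ 2 * h → 0 ≤ A + u → |secondPrimitive μ (t + u) -
      N * ((A + u) ^ (j + 2) / (j + 2).factorial)| ≤
      P * (Real.exp (2 * δ) * Real.exp (σ * t)) := fun u hu hAu => by
    have h1 := hJ (t + u)
    rw [show t + u + B = A + u by rw [hA]; ring, max_eq_left hAu] at h1
    exact h1.trans (mul_le_mul_of_nonneg_left (hexp u hu) hP)
  have hE : 4 * P * Real.exp (2 * δ) / δ ^ 2 * (σ ^ 2 * Real.exp (σ * t)) =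
      4 * (P * (Real.exp (2 * δ) * Real.exp (σ * t))) / h ^ 2 := by
    rw [hh]
    field_simp
  rw [hE]
  set R := P * (Real.exp (2 * δ) * Real.exp (σ * t)) with hR
  constructor
  · have h1 := sq_mul_measureReal_Iic_le hσ hμ hh0 t
    have a1 := abs_le.1 (hJ' (2 * h) le_rfl (by linarith))
    have a2 := abs_le.1 (hJ' h (by linarith) (by linarith))
    have a3 := abs_le.1 (hJ' 0 (by linarith) (by linarith))
    rw [add_zero, add_zero] at a3
    have b := mul_le_mul_of_nonneg_left (second_difference_pow_bounds hA0.le hh0 j).2 hN.le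
    have c := add_pow_le_mul_exp hA0 (by linarith : 0 ≤ 2 * h) j
    have d : (A + 2 * h) ^ j / j.factorial ≤ A ^ j / j.factorial * Real.exp (4 * δ) := by
      rw [div_mul_eq_mul_div]
      gcongr
      exact c.trans (by gcongr)
    have d' := mul_le_mul_of_nonneg_left d (by positivity : 0 ≤ N * h ^ 2)
    have f : h ^ 2 * μ.real (Iic t) ≤
        h ^ 2 * (N * (A ^ j / j.factorial) * Real.exp (4 * δ)) + 4 * R := by nlinarith
    rw [← sub_le_iff_le_add', le_div_iff₀ (by positivity)]
    linarith
  · have h1 := le_sq_mul_measureReal_Iic hσ hμ hh0 t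
    have a1 := abs_le.1 (hJ' 0 (by linarith) (by linarith))
    have a2 := abs_le.1 (hJ' (-h) (by linarith) (by linarith))
    have a3 := abs_le.1 (hJ' (-(2 * h)) (by linarith) (by linarith))
    rw [add_zero, add_zero] at a1
    rw [← sub_eq_add_neg, ← sub_eq_add_neg] at a2 a3
    have b := mul_le_mul_of_nonneg_left
      (second_difference_pow_bounds (by linarith : 0 ≤ A - 2 * h) hh0 j).1 hN.le
    rw [sub_add_cancel, show A - 2 * h + h = A - h by ring] at b
    have c := mul_exp_le_sub_pow hA0 (by linarith : 0 ≤ 2 * h) (by linarith) j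
    have d : A ^ j / j.factorial * Real.exp (-(8 * δ)) ≤ (A - 2 * h) ^ j / j.factorial := by
      rw [div_mul_eq_mul_div]
      gcongr
      refine le_trans ?_ c
      have : -(8 * δ) ≤ -(j * (2 * (2 * h / A))) := by linarith
      gcongr
    have d' := mul_le_mul_of_nonneg_left d (by positivity : 0 ≤ N * h ^ 2)
    have f : h ^ 2 * (N * (A ^ j / j.factorial) * Real.exp (-(8 * δ))) - 4 * R ≤
        h ^ 2 * μ.real (Iic t) := by nlinarith
    rw [sub_le_iff_le_add, ← sub_le_iff_le_add', le_div_iff₀ (by positivity)]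
    linarith

end SecondDifference

section LogExpansion

theorem hasDerivAt_logExpansion {b c d ε : ℝ} (hw : 1 + b * ε ≠ 0)
    (hQ : (1 + b * ε) ^ 2 + c * ε ^ 2 * (1 + b * ε) - d * ε ^ 3 ≠ 0) :
    HasDerivAt (fun ε : ℝ => -Real.log ((1 + b * ε) ^ 2 + c * ε ^ 2 * (1 + b * ε) - d * ε ^ 3) +
      4 * Real.log (1 + b * ε) + (1 + b * ε)⁻¹ - 1 -
      (b * ε - c * ε ^ 2 + (d + b * c - b ^ 3 / 3) * ε ^ 3))
      (ε ^ 3 * ((2 * b ^ 4 - 4 * b ^ 2 * c - 8 * b * d + 2 * c ^ 2 +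
        (5 * b ^ 5 - 11 * b ^ 3 * c - 17 * b ^ 2 * d + 3 * b * c ^ 2 - 5 * c * d) * ε +
        (4 * b ^ 6 - 8 * b ^ 4 * c - 12 * b ^ 3 * d - 3 * b ^ 2 * c ^ 2 - 10 * b * c * d +
          3 * d ^ 2) * ε ^ 2 +
        (b ^ 7 - 7 * b ^ 3 * c ^ 2 - 5 * b ^ 2 * c * d - 5 * b ^ 4 * d + 6 * b * d ^ 2) * ε ^ 3 +
        (3 * b ^ 2 * d ^ 2 - 3 * b ^ 4 * c ^ 2 + b ^ 6 * c - b ^ 5 * d) * ε ^ 4) /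
        (((1 + b * ε) ^ 2 + c * ε ^ 2 * (1 + b * ε) - d * ε ^ 3) * (1 + b * ε) ^ 2))) ε := by
  have hi := hasDerivAt_id ε
  have h1 : HasDerivAt (fun ε : ℝ => 1 + b * ε) b ε := by
    simpa using (hi.const_mul b).const_add 1
  have h2 : HasDerivAt (fun ε : ℝ => (1 + b * ε) ^ 2 + c * ε ^ 2 * (1 + b * ε) - d * ε ^ 3)
      (2 * b * (1 + b * ε) + (2 * c * ε * (1 + b * ε) + c * ε ^ 2 * b) - 3 * d * ε ^ 2) ε := by
    refine (((h1.pow 2).add (((hi.pow 2).const_mul c).mul h1)).sub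
      ((hi.pow 3).const_mul d)).congr_deriv ?_
    simp
    ring
  have h3 : HasDerivAt (fun ε : ℝ => b * ε - c * ε ^ 2 + (d + b * c - b ^ 3 / 3) * ε ^ 3)
      (b - 2 * c * ε + 3 * (d + b * c - b ^ 3 / 3) * ε ^ 2) ε := by
    refine (((hi.const_mul b).sub ((hi.pow 2).const_mul c)).add
      ((hi.pow 3).const_mul (d + b * c - b ^ 3 / 3))).congr_deriv ?_
    simp
    ring
  refine ((((((h2.log hQ).neg).add ((h1.log hw).const_mul 4)).add (h1.inv hw)).sub_const 1).sub
    h3).congr_deriv ?_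
  set w := 1 + b * ε with hwd
  set Q := w ^ 2 + c * ε ^ 2 * w - d * ε ^ 3 with hQd
  field_simp
  rw [hQd, hwd]
  ring

theorem exists_logExpansion_bound {b : ℝ} (hb : 0 ≤ b) (c d : ℝ) :
    ∃ ε₀ > 0, ∃ C > 0, ∀ ε, 0 ≤ ε → ε ≤ ε₀ →
      1 / 2 ≤ ((1 + b * ε) ^ 2 + c * ε ^ 2 * (1 + b * ε) - d * ε ^ 3) / (1 + b * ε) ^ 3 ∧
      |-Real.log (((1 + b * ε) ^ 2 + c * ε ^ 2 * (1 + b * ε) - d * ε ^ 3) / (1 + b * ε) ^ 3) +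
        Real.log (1 + b * ε) + (1 + b * ε)⁻¹ - 1 -
        (b * ε - c * ε ^ 2 + (d + b * c - b ^ 3 / 3) * ε ^ 3)| ≤ C * ε ^ 4 := by
  set Q : ℝ → ℝ := fun ε => (1 + b * ε) ^ 2 + c * ε ^ 2 * (1 + b * ε) - d * ε ^ 3 with hQ
  set N : ℝ → ℝ := fun ε => 2 * b ^ 4 - 4 * b ^ 2 * c - 8 * b * d + 2 * c ^ 2 +
        (5 * b ^ 5 - 11 * b ^ 3 * c - 17 * b ^ 2 * d + 3 * b * c ^ 2 - 5 * c * d) * ε +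
        (4 * b ^ 6 - 8 * b ^ 4 * c - 12 * b ^ 3 * d - 3 * b ^ 2 * c ^ 2 - 10 * b * c * d +
          3 * d ^ 2) * ε ^ 2 +
        (b ^ 7 - 7 * b ^ 3 * c ^ 2 - 5 * b ^ 2 * c * d - 5 * b ^ 4 * d + 6 * b * d ^ 2) * ε ^ 3 +
        (3 * b ^ 2 * d ^ 2 - 3 * b ^ 4 * c ^ 2 + b ^ 6 * c - b ^ 5 * d) * ε ^ 4 with hN
  have hQc : Continuous Q := by fun_prop
  have hNc : Continuous N := by fun_prop
  have hQ0 : Q 0 = 1 := by simp [hQ]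
  have c1 : ContinuousAt (fun ε => |N ε / (Q ε * (1 + b * ε) ^ 2)|) 0 :=
    (hNc.continuousAt.div (by fun_prop) (by simp [hQ0])).abs
  have c2 : ContinuousAt (fun ε => Q ε / (1 + b * ε) ^ 3) 0 :=
    hQc.continuousAt.div (by fun_prop) (by simp)
  have e1 := c1.eventually (gt_mem_nhds (lt_add_one _))
  have e2 := c2.eventually (lt_mem_nhds (show 1 / 2 < Q 0 / (1 + b * 0) ^ 3 by
    rw [hQ0]
    norm_num))
  obtain ⟨r, hr, hball⟩ := Metric.eventually_nhds_iff.1 (e1.and e2)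
  set C := |N 0 / (Q 0 * (1 + b * 0) ^ 2)| + 1 with hC
  have hCpos : 0 < C := by positivity
  have hall : ∀ ε, 0 ≤ ε → ε ≤ r / 2 → |N ε / (Q ε * (1 + b * ε) ^ 2)| < C ∧
      1 / 2 < Q ε / (1 + b * ε) ^ 3 := fun ε h0 h1 => hball (by
    rw [Real.dist_eq, sub_zero, abs_of_nonneg h0]
    linarith)
  have hw : ∀ ε, 0 ≤ ε → 0 < 1 + b * ε := fun ε h0 => by positivity
  have hQpos : ∀ ε, 0 ≤ ε → ε ≤ r / 2 → 0 < Q ε := fun ε h0 h1 => by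
    have h2 := (hall ε h0 h1).2
    have h3 := hw ε h0
    rw [lt_div_iff₀ (by positivity)] at h2
    exact lt_trans (by positivity) h2
  refine ⟨r / 2, by positivity, C, hCpos, fun ε h0 h1 => ⟨(hall ε h0 h1).2.le, ?_⟩⟩
  have hder : ∀ x ∈ Icc 0 ε, HasDerivWithinAt (fun ε : ℝ => -Real.log (Q ε) +
      4 * Real.log (1 + b * ε) + (1 + b * ε)⁻¹ - 1 -
      (b * ε - c * ε ^ 2 + (d + b * c - b ^ 3 / 3) * ε ^ 3))
      (x ^ 3 * (N x / (Q x * (1 + b * x) ^ 2))) (Icc 0 ε) x := fun x hx =>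
    (hasDerivAt_logExpansion (hw x hx.1).ne' (hQpos x hx.1 (hx.2.trans h1)).ne').hasDerivWithinAt
  have hbd : ∀ x ∈ Icc 0 ε, ‖x ^ 3 * (N x / (Q x * (1 + b * x) ^ 2))‖ ≤ ε ^ 3 * C := fun x hx => by
    rw [norm_mul, Real.norm_eq_abs, Real.norm_eq_abs, abs_of_nonneg (pow_nonneg hx.1 3)]
    have := (hall x hx.1 (hx.2.trans h1)).1.le
    have h2 := hx.2
    have h3 := hx.1
    gcongr
  have key := (convex_Icc 0 ε).norm_image_sub_le_of_norm_hasDerivWithin_le hder hbd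
    (left_mem_Icc.2 h0) (right_mem_Icc.2 h0)
  rw [Real.norm_eq_abs, Real.norm_eq_abs, sub_zero, abs_of_nonneg h0, hQ0] at key
  rw [Real.log_div (hQpos ε h0 h1).ne' (pow_pos (hw ε h0) 3).ne', Real.log_pow]
  refine le_trans (le_of_eq ?_) (key.trans_eq ?_)
  · congr 1
    simp
    ring
  · ring

end LogExpansion

section TiltExpansion

theorem abs_exp_neg_sub_cubic_le {u : ℝ} (hu : 0 ≤ u) :
    |Real.exp (-u) - (1 - u + u ^ 2 / 2 - u ^ 3 / 6)| ≤ 4 * u ^ 4 := by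
  rcases le_total u 1 with h | h
  · have := Real.exp_bound (x := -u) (n := 4) (by rwa [abs_neg, abs_of_nonneg hu]) (by norm_num)
    rw [abs_neg, abs_of_nonneg hu] at this
    norm_num [Finset.sum_range_succ, Nat.factorial] at this
    have e : Real.exp (-u) - (1 - u + u ^ 2 / 2 - u ^ 3 / 6) =
        Real.exp (-u) - (1 + -u + u ^ 2 / 2 + (-u) ^ 3 / 6) := by ring
    rw [e]
    refine this.trans ?_
    have : 0 ≤ u ^ 4 := by positivity
    linarith
  · have h0 := Real.exp_pos (-u)
    have h1 : Real.exp (-u) ≤ 1 := Real.exp_le_one_iff.2 (by linarith)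
    have h2 : u ≤ u ^ 2 := by nlinarith
    have h3 : u ^ 2 ≤ u ^ 3 := by nlinarith
    have h4 : u ^ 3 ≤ u ^ 4 := by nlinarith [pow_nonneg hu 3]
    rw [abs_le]
    constructor <;> linarith

variable {τ : Measure ℝ} [IsFiniteMeasure τ] {σ : ℝ}

theorem abs_laplaceReal_sub_le (hpos : ∀ᵐ x ∂τ, 0 < x) (h1 : Integrable (fun x => x) τ)
    (h2 : Integrable (fun x => x ^ 2) τ) (h3 : Integrable (fun x => x ^ 3) τ)
    (h4 : Integrable (fun x => x ^ 4) τ) (hσ : 0 ≤ σ) :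
    |laplaceReal τ σ - (τ.real univ - σ * ∫ x, x ∂τ + σ ^ 2 / 2 * ∫ x, x ^ 2 ∂τ -
      σ ^ 3 / 6 * ∫ x, x ^ 3 ∂τ)| ≤ 4 * (∫ x, x ^ 4 ∂τ) * σ ^ 4 := by
  have i0 := integrable_const (μ := τ) (1 : ℝ)
  have i1 := h1.const_mul σ
  have i2 := h2.const_mul (σ ^ 2 / 2)
  have i3 := h3.const_mul (σ ^ 3 / 6)
  have e : laplaceReal τ σ - (τ.real univ - σ * ∫ x, x ∂τ + σ ^ 2 / 2 * ∫ x, x ^ 2 ∂τ -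
      σ ^ 3 / 6 * ∫ x, x ^ 3 ∂τ) =
      ∫ x, (Real.exp (-σ * x) - (1 - σ * x + σ ^ 2 / 2 * x ^ 2 - σ ^ 3 / 6 * x ^ 3)) ∂τ := by
    have j1 : Integrable (fun x => 1 - σ * x) τ := i0.sub i1
    have j2 : Integrable (fun x => 1 - σ * x + σ ^ 2 / 2 * x ^ 2) τ := j1.add i2
    have j3 : Integrable (fun x => 1 - σ * x + σ ^ 2 / 2 * x ^ 2 - σ ^ 3 / 6 * x ^ 3) τ := j2.sub i3
    rw [integral_sub (integrable_rexp_finite hpos hσ) j3, integral_sub j2 i3, integral_add j1 i2,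
      integral_sub i0 i1, integral_const_mul, integral_const_mul, integral_const_mul, laplaceReal]
    simp
  rw [e, ← Real.norm_eq_abs]
  refine (norm_integral_le_of_norm_le (h4.const_mul (4 * σ ^ 4)) ?_).trans_eq ?_
  · filter_upwards [hpos] with x hx
    have := abs_exp_neg_sub_cubic_le (mul_nonneg hσ hx.le)
    rw [Real.norm_eq_abs]
    refine (le_of_eq ?_).trans (this.trans_eq ?_)
    · congr 1
      rw [neg_mul]
      ring
    · ring
  · rw [integral_const_mul]
    ring

theorem abs_tiltedMean_sub_le (hpos : ∀ᵐ x ∂τ, 0 < x) (h1 : Integrable (fun x => x) τ)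
    (h2 : Integrable (fun x => x ^ 2) τ) (hσ : 0 ≤ σ) (hm : 0 < τ.real univ)
    (hL : τ.real univ / 2 ≤ laplaceReal τ σ) :
    |tiltedMean τ σ - (∫ x, x ∂τ) / τ.real univ| ≤
      2 * (τ.real univ * (∫ x, x ^ 2 ∂τ) + (∫ x, x ∂τ) ^ 2) / τ.real univ ^ 2 * σ := by
  set m := τ.real univ
  set m1 := ∫ x, x ∂τ with hm1d
  set m2 := ∫ x, x ^ 2 ∂τ with hm2d
  set L := laplaceReal τ σ with hLd
  have hL0 : 0 < L := by linarith
  have hm1 : 0 ≤ m1 := integral_nonneg_of_ae (hpos.mono fun x hx => hx.le)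
  have hm2 : 0 ≤ m2 := integral_nonneg fun x => sq_nonneg x
  have hi := integrable_mul_rexp_of_ae_pos hpos hσ h1
  have hLm : L ≤ m := laplaceReal_le hpos hσ
  have hLm' : m - σ * m1 ≤ L := sub_le_laplaceReal hpos h1 hσ
  have hIm : ∫ x, x * Real.exp (-σ * x) ∂τ ≤ m1 := by
    refine integral_mono_ae hi h1 ?_
    filter_upwards [hpos] with x hx
    exact mul_le_of_le_one_right hx.le (Real.exp_le_one_iff.2 (by nlinarith))
  have hIm' : m1 - σ * m2 ≤ ∫ x, x * Real.exp (-σ * x) ∂τ := by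
    rw [hm1d, hm2d, ← integral_const_mul, ← integral_sub h1 (h2.const_mul σ)]
    refine integral_mono_ae (h1.sub (h2.const_mul σ)) hi ?_
    filter_upwards [hpos] with x hx
    have := Real.add_one_le_exp (-σ * x)
    nlinarith
  set I := ∫ x, x * Real.exp (-σ * x) ∂τ with hI
  have e : tiltedMean τ σ - m1 / m = (I * m - m1 * L) / (L * m) := by
    rw [tiltedMean, ← hLd, div_sub_div _ _ hL0.ne' hm.ne']
    ring
  rw [e, abs_div, abs_of_pos (mul_pos hL0 hm), div_le_iff₀ (by positivity)]
  have hle : |I * m - m1 * L| ≤ σ * (m * m2 + m1 ^ 2) := by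
    rw [abs_le]
    constructor <;> nlinarith [mul_nonneg hσ hm1, mul_nonneg hσ hm2, mul_nonneg hm.le hm2,
      mul_nonneg hσ (sq_nonneg m1), mul_nonneg hσ (mul_nonneg hm.le hm2)]
  refine hle.trans ?_
  calc σ * (m * m2 + m1 ^ 2) = 2 * (m * m2 + m1 ^ 2) / m ^ 2 * σ * (m / 2 * m) := by
        field_simp
    _ ≤ _ := by gcongr

theorem abs_log_sub_log_le {x y : ℝ} (hx : 1 / 4 ≤ x) (hy : 1 / 4 ≤ y) :
    |Real.log x - Real.log y| ≤ 4 * |x - y| := by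
  have key : ∀ {x y : ℝ}, 1 / 4 ≤ x → 1 / 4 ≤ y → Real.log x - Real.log y ≤ 4 * |x - y| :=
    fun {x y} hx hy => by
      have hx0 : 0 < x := by linarith
      have hy0 : 0 < y := by linarith
      rw [← Real.log_div hx0.ne' hy0.ne']
      refine (Real.log_le_sub_one_of_pos (div_pos hx0 hy0)).trans ?_
      have e : x / y - 1 = (x - y) / y := by field_simp
      rw [e, div_le_iff₀ hy0]
      nlinarith [le_abs_self (x - y), abs_nonneg (x - y)]
  rw [abs_le]
  constructor
  · have := key hy hx
    rw [abs_sub_comm] at this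
    linarith
  · exact key hx hy

theorem exists_log_laplaceReal_bound (hpos : ∀ᵐ x ∂τ, 0 < x) (h1 : Integrable (fun x => x) τ)
    (h2 : Integrable (fun x => x ^ 2) τ) (h3 : Integrable (fun x => x ^ 3) τ)
    (h4 : Integrable (fun x => x ^ 4) τ) {m b c d : ℝ} (hm : 0 < m) (hτ : τ.real univ = m)
    (hb : ∫ x, x ∂τ = b * m) (hc : ∫ x, x ^ 2 ∂τ = 2 * c * m) (hd : ∫ x, x ^ 3 ∂τ = 6 * d * m)
    (hb0 : 0 ≤ b) :
    ∃ ε₀ > 0, ∃ C > 0, ∀ ε, 0 ≤ ε → ε ≤ ε₀ →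
      m / 2 ≤ laplaceReal τ (ε / (1 + b * ε)) ∧
      |tiltedMean τ (ε / (1 + b * ε)) - b| ≤ C * ε ∧
      |-Real.log (laplaceReal τ (ε / (1 + b * ε)) / m) + Real.log (1 + b * ε) +
        (1 + b * ε)⁻¹ - 1 - (b * ε - c * ε ^ 2 + (d + b * c - b ^ 3 / 3) * ε ^ 3)| ≤ C * ε ^ 4 := by
  obtain ⟨ε₁, hε₁, C₁, hC₁, hlog⟩ := exists_logExpansion_bound hb0 c d
  set M4 := ∫ x, x ^ 4 ∂τ with hM4
  have hM40 : 0 ≤ M4 := integral_nonneg fun x => by positivity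
  have hc0 : 0 ≤ c := by
    have : 0 ≤ ∫ x, x ^ 2 ∂τ := integral_nonneg fun x => sq_nonneg x
    rw [hc] at this
    nlinarith
  set C₂ := 2 * (m * (2 * c * m) + (b * m) ^ 2) / m ^ 2 with hC₂
  have hC₂0 : 0 ≤ C₂ := by positivity
  refine ⟨min ε₁ (1 / (2 * (b + 1))), by positivity, C₁ + 16 * M4 / m + C₂, by positivity,
    fun ε h0 hε => ?_⟩
  have hεb : ε * b ≤ 1 / 2 := by
    have := hε.trans (min_le_right _ _)
    rw [le_div_iff₀ (by positivity)] at this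
    nlinarith
  obtain ⟨hq, hG⟩ := hlog ε h0 (hε.trans (min_le_left _ _))
  have hw : 1 ≤ 1 + b * ε := by
    have := mul_nonneg hb0 h0
    linarith
  have hw0 : 0 < 1 + b * ε := by linarith
  set σ := ε / (1 + b * ε) with hσd
  have hσ : 0 ≤ σ := by positivity
  have hσε : σ ≤ ε := div_le_self h0 hw
  have hL : m / 2 ≤ laplaceReal τ σ := by
    have := sub_le_laplaceReal hpos h1 hσ
    rw [hτ, hb] at this
    have h5 : σ * (b * m) ≤ m / 2 := by
      calc σ * (b * m) ≤ ε * (b * m) := by gcongr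
        _ = ε * b * m := by ring
        _ ≤ 1 / 2 * m := by gcongr
        _ = m / 2 := by ring
    linarith
  refine ⟨hL, ?_, ?_⟩
  · have := abs_tiltedMean_sub_le hpos h1 h2 hσ (hτ ▸ hm) (hτ ▸ hL)
    rw [hτ, hb, hc, mul_div_cancel_right₀ _ hm.ne'] at this
    refine this.trans ?_
    have h6 : C₂ ≤ C₁ + 16 * M4 / m + C₂ := by
      have : 0 ≤ 16 * M4 / m := by positivity
      linarith
    gcongr
  · set q := ((1 + b * ε) ^ 2 + c * ε ^ 2 * (1 + b * ε) - d * ε ^ 3) / (1 + b * ε) ^ 3 with hqd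
    have hqσ : q = 1 - b * σ + c * σ ^ 2 - d * σ ^ 3 := by
      rw [hqd, hσd]
      field_simp
      ring
    have hℓ : 1 / 2 ≤ laplaceReal τ σ / m := by
      rw [le_div_iff₀ hm]
      linarith
    have hdiff : |laplaceReal τ σ / m - q| ≤ 4 * M4 / m * ε ^ 4 := by
      have h5 := abs_laplaceReal_sub_le hpos h1 h2 h3 h4 hσ
      rw [hτ, hb, hc, hd] at h5
      have e : laplaceReal τ σ / m - q = (laplaceReal τ σ - (m - σ * (b * m) +
          σ ^ 2 / 2 * (2 * c * m) - σ ^ 3 / 6 * (6 * d * m))) / m := by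
        rw [hqσ]
        field_simp
      rw [e, abs_div, abs_of_pos hm, div_le_iff₀ hm]
      refine h5.trans ?_
      calc 4 * M4 * σ ^ 4 ≤ 4 * M4 * ε ^ 4 := by gcongr
        _ = 4 * M4 / m * ε ^ 4 * m := by field_simp
    have hlogs := abs_log_sub_log_le (x := q) (y := laplaceReal τ σ / m) (by linarith) (by linarith)
    rw [abs_sub_comm q] at hlogs
    have e : -Real.log (laplaceReal τ σ / m) + Real.log (1 + b * ε) +
        (1 + b * ε)⁻¹ - 1 - (b * ε - c * ε ^ 2 + (d + b * c - b ^ 3 / 3) * ε ^ 3) =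
        (-Real.log q + Real.log (1 + b * ε) +
        (1 + b * ε)⁻¹ - 1 - (b * ε - c * ε ^ 2 + (d + b * c - b ^ 3 / 3) * ε ^ 3)) +
        (Real.log q - Real.log (laplaceReal τ σ / m)) := by ring
    rw [e]
    refine (abs_add_le _ _).trans ?_
    have h7 : 0 ≤ C₂ * ε ^ 4 := by positivity
    calc _ ≤ C₁ * ε ^ 4 + 4 * (4 * M4 / m * ε ^ 4) := by
          refine add_le_add hG (hlogs.trans ?_)
          gcongr
      _ ≤ C₁ * ε ^ 4 + 4 * (4 * M4 / m * ε ^ 4) + C₂ * ε ^ 4 := by linarith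
      _ = _ := by ring

end TiltExpansion

section Asymptotics

theorem factorial_mul_exp_le {n : ℕ} (hn : 0 < n) :
    (n.factorial : ℝ) * Real.exp n ≤ Real.exp 1 * √n * (n : ℝ) ^ n := by
  obtain ⟨k, rfl⟩ : ∃ k, n = k + 1 := ⟨n - 1, by omega⟩
  have h : Stirling.stirlingSeq (k + 1) ≤ Stirling.stirlingSeq 1 :=
    Stirling.stirlingSeq'_antitone (Nat.zero_le k)
  have hs : (0 : ℝ) < √2 := by positivity
  rw [Stirling.stirlingSeq_one, Stirling.stirlingSeq, div_le_div_iff₀ (by positivity) hs,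
    Real.sqrt_mul (by norm_num), div_pow, ← Real.exp_nat_mul, mul_one] at h
  have hk : (0 : ℝ) < ((k + 1 : ℕ) : ℝ) := by positivity
  have he := Real.exp_pos ((k + 1 : ℕ) : ℝ)
  have h2 : ((k + 1).factorial : ℝ) * √2 ≤
      (Real.exp 1 * √((k + 1 : ℕ) : ℝ) * ((k + 1 : ℕ) : ℝ) ^ (k + 1) /
        Real.exp ((k + 1 : ℕ) : ℝ)) * √2 := by
    refine h.trans (le_of_eq ?_)
    ring
  have h3 := le_of_mul_le_mul_right h2 hs
  rwa [le_div_iff₀ he] at h3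

theorem sub_one_sub_log_le {x : ℝ} (hx : 1 / 2 ≤ x) : x - 1 - Real.log x ≤ 2 * (x - 1) ^ 2 := by
  have hx0 : 0 < x := by linarith
  have h := Real.one_sub_inv_le_log_of_pos hx0
  have e : x - 1 - (1 - x⁻¹) = (x - 1) ^ 2 * x⁻¹ := by
    field_simp
  have hi : x⁻¹ ≤ 2 := by
    rw [inv_le_comm₀ hx0 (by norm_num)]
    linarith
  nlinarith [mul_le_mul_of_nonneg_left hi (sq_nonneg (x - 1))]

theorem tendsto_one_of_forall_exp_bounds {r E : ℕ → ℝ} (c : ℝ → ℝ) (hE : Tendsto E atTop (𝓝 0))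
    (h : ∀ δ > 0, ∀ᶠ j in atTop, r j ≤ Real.exp (4 * δ) + c δ * E j ∧
      Real.exp (-(8 * δ)) - c δ * E j ≤ r j) : Tendsto r atTop (𝓝 1) := by
  have hu : Tendsto (fun δ : ℝ => Real.exp (4 * δ)) (𝓝[>] 0) (𝓝 1) := by
    have : Tendsto (fun δ : ℝ => Real.exp (4 * δ)) (𝓝 0) (𝓝 (Real.exp (4 * 0))) :=
      Continuous.tendsto (by fun_prop) 0
    rw [mul_zero, Real.exp_zero] at this
    exact this.mono_left nhdsWithin_le_nhds
  have hl : Tendsto (fun δ : ℝ => Real.exp (-(8 * δ))) (𝓝[>] 0) (𝓝 1) := by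
    have : Tendsto (fun δ : ℝ => Real.exp (-(8 * δ))) (𝓝 0) (𝓝 (Real.exp (-(8 * 0)))) :=
      Continuous.tendsto (by fun_prop) 0
    rw [mul_zero, neg_zero, Real.exp_zero] at this
    exact this.mono_left nhdsWithin_le_nhds
  refine tendsto_order.2 ⟨fun y hy => ?_, fun y hy => ?_⟩
  · obtain ⟨δ, hδy, hδ⟩ := ((hl.eventually_const_lt hy).and self_mem_nhdsWithin).exists
    have hlim : Tendsto (fun j => Real.exp (-(8 * δ)) - c δ * E j) atTop
        (𝓝 (Real.exp (-(8 * δ)))) := by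
      simpa using tendsto_const_nhds.sub (hE.const_mul (c δ))
    filter_upwards [h δ hδ, hlim.eventually_const_lt hδy] with j hj hj2
    exact hj2.trans_le hj.2
  · obtain ⟨δ, hδy, hδ⟩ := ((hu.eventually_lt_const hy).and self_mem_nhdsWithin).exists
    have hlim : Tendsto (fun j => Real.exp (4 * δ) + c δ * E j) atTop
        (𝓝 (Real.exp (4 * δ))) := by
      simpa using tendsto_const_nhds.add (hE.const_mul (c δ))
    filter_upwards [h δ hδ, hlim.eventually_lt_const hδy] with j hj hj2
    exact hj.1.trans_lt hj2

section SaddlePoint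

variable {j : ℕ} {t ε a b m L : ℝ}

theorem saddlePoint_mul_eq (ht : 0 < t) (hε : ε = j / t) (hw : 0 < 1 + b * ε) :
    t + j * a = t * (1 + ε / (1 + b * ε) * (a - b)) * (1 + b * ε) ∧
      ε / (1 + b * ε) * (t + j * a) = j * (1 + ε / (1 + b * ε) * (a - b)) := by
  have hj : (j : ℝ) = ε * t := by rw [hε]; field_simp
  have h : t + j * a = t * (1 + ε / (1 + b * ε) * (a - b)) * (1 + b * ε) := by
    have e : ε / (1 + b * ε) * (1 + b * ε) = ε := div_mul_cancel₀ _ hw.ne'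
    rw [hj]
    linear_combination -t * (a - b) * e
  refine ⟨h, ?_⟩
  rw [h, hj]
  linear_combination t * (1 + ε / (1 + b * ε) * (a - b)) * div_mul_cancel₀ ε hw.ne'

theorem saddlePoint_mainTerm_eq (ht : 0 < t) (hε : ε = j / t) (hw : 0 < 1 + b * ε) (hm : 0 < m)
    (hL : 0 < L) (hv : 0 < 1 + ε / (1 + b * ε) * (a - b)) :
    (L ^ j)⁻¹ * Real.exp (-(ε / (1 + b * ε)) * (j * a)) * ((t + j * a) ^ j / j.factorial) =
      t ^ j / (m ^ j * j.factorial) * Real.exp (j *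
        (Real.log (1 + ε / (1 + b * ε) * (a - b)) - (1 + ε / (1 + b * ε) * (a - b)) + 1 +
          (-Real.log (L / m) + Real.log (1 + b * ε) + (1 + b * ε)⁻¹ - 1))) := by
  rw [(saddlePoint_mul_eq ht hε hw).1]
  set v := 1 + ε / (1 + b * ε) * (a - b) with hvd
  have e : ε / (1 + b * ε) * a = v - (1 + b * ε)⁻¹ := by
    rw [hvd]
    linear_combination mul_inv_cancel₀ hw.ne'
  have e2 : (j : ℝ) * (Real.log v - v + 1 +
      (-Real.log (L / m) + Real.log (1 + b * ε) + (1 + b * ε)⁻¹ - 1)) =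
      j * Real.log v + -(j * Real.log (L / m)) + j * Real.log (1 + b * ε) +
        (-(ε / (1 + b * ε)) * (j * a)) := by
    linear_combination (j : ℝ) * e
  rw [e2, Real.exp_add, Real.exp_add, Real.exp_add, Real.exp_neg, Real.exp_nat_mul,
    Real.exp_nat_mul, Real.exp_nat_mul, Real.exp_log hv, Real.exp_log hw,
    Real.exp_log (div_pos hL hm)]
  rw [mul_pow, mul_pow, div_pow]
  field_simp

theorem saddlePoint_errorTerm_eq (hj : 0 < j) (ht : 0 < t) (hε : ε = j / t) (hw : 0 < 1 + b * ε)
    (hL : 0 < L) (hv : 0 < 1 + ε / (1 + b * ε) * (a - b)) :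
    Real.exp (ε / (1 + b * ε) * t) * ((ε / (1 + b * ε) * L) ^ j)⁻¹ =
      (L ^ j)⁻¹ * Real.exp (-(ε / (1 + b * ε)) * (j * a)) * ((t + j * a) ^ j / j.factorial) *
      (j.factorial * Real.exp j / (j : ℝ) ^ j *
        Real.exp (j * ((1 + ε / (1 + b * ε) * (a - b)) - 1 -
          Real.log (1 + ε / (1 + b * ε) * (a - b))))) := by
  obtain ⟨h1, h2⟩ := saddlePoint_mul_eq (a := a) ht hε hw
  set v := 1 + ε / (1 + b * ε) * (a - b) with hvd
  set σ := ε / (1 + b * ε) with hσ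
  have hj0 : (0 : ℝ) < j := by exact_mod_cast hj
  have hA : 0 < t + j * a := by
    rw [h1]
    positivity
  have hε0 : 0 < ε := by rw [hε]; positivity
  have hσ0 : 0 < σ := by positivity
  have e2 : (j : ℝ) * (v - 1 - Real.log v) =
      (σ * t + σ * (j * a)) + -(j : ℝ) + -(j * Real.log v) := by
    linear_combination -h2
  rw [e2, Real.exp_add, Real.exp_add, Real.exp_add, Real.exp_neg, Real.exp_neg, neg_mul,
    Real.exp_neg, Real.exp_nat_mul, Real.exp_log hv]
  have e3 : ((t + j * a) ^ j) * σ ^ j = (j : ℝ) ^ j * v ^ j := by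
    rw [← mul_pow, ← mul_pow, mul_comm, h2]
  rw [mul_pow]
  field_simp
  linear_combination -e3

theorem saddlePoint_errorTerm_le {C : ℝ} (hj : 0 < j) (ht : 0 < t) (hε : ε = j / t)
    (hw : 0 < 1 + b * ε) (hL : 0 < L) (hv : 1 / 2 ≤ 1 + ε / (1 + b * ε) * (a - b))
    (hvC : |ε / (1 + b * ε) * (a - b)| ≤ C * ε ^ 2) :
    Real.exp (ε / (1 + b * ε) * t) * ((ε / (1 + b * ε) * L) ^ j)⁻¹ ≤
      (L ^ j)⁻¹ * Real.exp (-(ε / (1 + b * ε)) * (j * a)) * ((t + j * a) ^ j / j.factorial) *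
      (Real.exp 1 * √j * Real.exp (2 * C ^ 2 * (j * ε ^ 4))) := by
  have hv0 : 0 < 1 + ε / (1 + b * ε) * (a - b) := by linarith
  rw [saddlePoint_errorTerm_eq hj ht hε hw hL hv0]
  have hA : 0 < t + j * a := by
    rw [(saddlePoint_mul_eq (a := a) ht hε hw).1]
    positivity
  have hj0 : (0 : ℝ) < j := by exact_mod_cast hj
  have hsq : (ε / (1 + b * ε) * (a - b)) ^ 2 ≤ C ^ 2 * ε ^ 4 := by
    calc _ = |ε / (1 + b * ε) * (a - b)| ^ 2 := (sq_abs _).symm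
      _ ≤ (C * ε ^ 2) ^ 2 := by gcongr
      _ = _ := by ring
  have hlog := sub_one_sub_log_le hv
  rw [add_sub_cancel_left] at hlog ⊢
  refine mul_le_mul_of_nonneg_left (mul_le_mul ?_ (Real.exp_le_exp.2 ?_) (by positivity)
    (by positivity)) (by positivity)
  · rw [div_le_iff₀ (by positivity)]
    exact factorial_mul_exp_le hj
  · calc _ ≤ (j : ℝ) * (2 * (C ^ 2 * ε ^ 4)) := by
          gcongr
          refine hlog.trans ?_
          gcongr
      _ = _ := by ring

end SaddlePoint

theorem tendsto_zero_of_mul_pow_four {ε : ℕ → ℝ} (h0 : ∀ j, 0 ≤ ε j)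
    (h : Tendsto (fun j : ℕ => (j : ℝ) * ε j ^ 4) atTop (𝓝 0)) : Tendsto ε atTop (𝓝 0) := by
  refine tendsto_order.2 ⟨fun y hy => Eventually.of_forall fun j => hy.trans_le (h0 j),
    fun y hy => ?_⟩
  filter_upwards [h.eventually_lt_const (pow_pos hy 4), eventually_ge_atTop 1] with j hj hj1
  have hj2 : (1 : ℝ) ≤ j := by exact_mod_cast hj1
  refine lt_of_pow_lt_pow_left₀ 4 hy.le (lt_of_le_of_lt ?_ hj)
  exact le_mul_of_one_le_left (pow_nonneg (h0 j) 4) hj2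

end Asymptotics

section SumConvPow

variable {ρ : Measure ℝ} [IsProbabilityMeasure ρ]

theorem tendsto_convPow_sum_convPow_div (hpos : ∀ᵐ x ∂ρ, 0 < x)
    (h1 : Integrable (fun x => x) ρ) (h2 : Integrable (fun x => x ^ 2) ρ)
    (h3 : Integrable (fun x => x ^ 3) ρ) (h4 : Integrable (fun x => x ^ 4) ρ)
    (h5 : Integrable (fun x => x ^ 5) ρ) {m b c d : ℝ} (hm : ∫ x, x ∂ρ = m)
    (hb : ∫ x, x ^ 2 ∂ρ = 2 * b * m) (hc : ∫ x, x ^ 3 ∂ρ = 6 * c * m)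
    (hd : ∫ x, x ^ 4 ∂ρ = 24 * d * m) {t : ℕ → ℝ} (ht : ∀ j, 0 < t j)
    (hlim : Tendsto (fun j : ℕ => (j : ℝ) * (j / t j) ^ 4) atTop (𝓝 0)) :
    Tendsto (fun j : ℕ =>
      (convPow (Measure.sum fun n => convPow ρ n) j).real (Iic (t j)) /
        (t j ^ j / (m ^ j * j.factorial) * Real.exp (j * (b * (j / t j) - c * (j / t j) ^ 2 +
          (d + b * c - b ^ 3 / 3) * (j / t j) ^ 3)))) atTop (𝓝 1) := by
  have hfin := isFiniteMeasure_tailMeasure hpos h1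
  have hm0 : 0 < m := hm ▸ integral_id_pos hpos h1
  have hb0 : 0 ≤ b := by
    have : 0 ≤ ∫ x, x ^ 2 ∂ρ := integral_nonneg fun x => sq_nonneg x
    rw [hb] at this
    nlinarith
  obtain ⟨ε₀, hε₀, C, hC, hlog⟩ := exists_log_laplaceReal_bound (τ := tailMeasure ρ)
    (m := m) (b := b) (c := c) (d := d) ae_pos_tailMeasure
    (by simpa using integrable_pow_tailMeasure (k := 1) hpos h2)
    (integrable_pow_tailMeasure (k := 2) hpos h3) (integrable_pow_tailMeasure (k := 3) hpos h4)
    (integrable_pow_tailMeasure (k := 4) hpos h5) hm0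
    (by simpa [hm] using integral_pow_tailMeasure (k := 0) hpos (by simpa using h1))
    (by
      have := integral_pow_tailMeasure (k := 1) hpos h2
      simp only [pow_one] at this
      rw [this, hb]
      push_cast
      ring)
    (by
      rw [integral_pow_tailMeasure (k := 2) hpos h3, hc]
      push_cast
      ring)
    (by
      rw [integral_pow_tailMeasure (k := 3) hpos h4, hd]
      push_cast
      ring) hb0
  obtain ⟨σ₀, hσ₀, K, hK, hsec⟩ := exists_secondPrimitive_bound hpos h1 h2 h3
  set τ := tailMeasure ρ
  set ν := Measure.sum fun n => convPow ρ n with hν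
  set ε : ℕ → ℝ := fun j => j / t j with hε
  have hε0 : ∀ j, 0 ≤ ε j := fun j => div_nonneg (Nat.cast_nonneg j) (ht j).le
  have hεlim : Tendsto ε atTop (𝓝 0) := tendsto_zero_of_mul_pow_four hε0 hlim
  have hw : ∀ j, 0 < 1 + b * ε j := fun j => by
    have := mul_nonneg hb0 (hε0 j)
    linarith
  set σ : ℕ → ℝ := fun j => ε j / (1 + b * ε j) with hσ
  have hσε : ∀ j, σ j ≤ ε j := fun j => by
    refine div_le_self (hε0 j) ?_
    have := mul_nonneg hb0 (hε0 j)
    linarith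
  have hσ0 : ∀ j, 0 ≤ σ j := fun j => div_nonneg (hε0 j) (hw j).le
  set L : ℕ → ℝ := fun j => laplaceReal τ (σ j) with hL
  set a : ℕ → ℝ := fun j => tiltedMean τ (σ j) with ha
  set x : ℕ → ℝ := fun j => j * ε j ^ 4 with hx
  have hev : ∀ᶠ j : ℕ in atTop, 5 ≤ j ∧ ε j ≤ ε₀ ∧ ε j ≤ σ₀ ∧ C * ε j ^ 2 ≤ 1 / 2 := by
    have hq : Tendsto (fun j => C * ε j ^ 2) atTop (𝓝 0) := by
      simpa using (hεlim.pow 2).const_mul C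
    filter_upwards [eventually_ge_atTop 5, hεlim.eventually_le_const hε₀,
      hεlim.eventually_le_const hσ₀, hq.eventually_le_const (by norm_num : (0 : ℝ) < 1 / 2)]
      with j e1 e2 e3 e4 using ⟨e1, e2, e3, e4⟩
  have hLpos : ∀ j, ε j ≤ ε₀ → 0 < L j := fun j hj => by
    have := (hlog (ε j) (hε0 j) hj).1
    have h6 : m / 2 ≤ L j := this
    linarith
  have hvC : ∀ j, ε j ≤ ε₀ → |σ j * (a j - b)| ≤ C * ε j ^ 2 := fun j hj => by
    have := (hlog (ε j) (hε0 j) hj).2.1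
    rw [abs_mul, abs_of_nonneg (hσ0 j)]
    calc σ j * |a j - b| ≤ ε j * (C * ε j) := by
          gcongr
          · exact hε0 j
          · exact hσε j
      _ = _ := by ring
  set M : ℕ → ℝ := fun j => (L j ^ j)⁻¹ * Real.exp (-σ j * (j * a j)) *
    ((t j + j * a j) ^ j / j.factorial) with hM
  set T : ℕ → ℝ := fun j => t j ^ j / (m ^ j * j.factorial) *
    Real.exp (j * (b * ε j - c * ε j ^ 2 + (d + b * c - b ^ 3 / 3) * ε j ^ 3)) with hT
  have hMT : Tendsto (fun j => M j / T j) atTop (𝓝 1) := by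
    set G : ℕ → ℝ := fun j => Real.log (1 + σ j * (a j - b)) - (1 + σ j * (a j - b)) + 1 +
      (-Real.log (L j / m) + Real.log (1 + b * ε j) + (1 + b * ε j)⁻¹ - 1 -
        (b * ε j - c * ε j ^ 2 + (d + b * c - b ^ 3 / 3) * ε j ^ 3)) with hG
    have hGlim : Tendsto (fun j : ℕ => (j : ℝ) * G j) atTop (𝓝 0) := by
      refine squeeze_zero_norm' (a := fun j => (2 * C ^ 2 + C) * x j) ?_
        (by simpa using hlim.const_mul (2 * C ^ 2 + C))
      filter_upwards [hev] with j hj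
      obtain ⟨hj5, hj1, hj2, hj3⟩ := hj
      have e1 := hvC j hj1
      have e2 := (hlog (ε j) (hε0 j) hj1).2.2
      have hv : 1 / 2 ≤ 1 + σ j * (a j - b) := by
        have := (abs_le.1 e1).1
        linarith
      have e3 := sub_one_sub_log_le hv
      have e4 := Real.log_le_sub_one_of_pos (x := 1 + σ j * (a j - b)) (by linarith)
      have hsq : (σ j * (a j - b)) ^ 2 ≤ C ^ 2 * ε j ^ 4 := by
        calc _ = |σ j * (a j - b)| ^ 2 := (sq_abs _).symm
          _ ≤ (C * ε j ^ 2) ^ 2 := by gcongr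
          _ = _ := by ring
      rw [add_sub_cancel_left] at e3
      rw [Real.norm_eq_abs, abs_mul, abs_of_nonneg (Nat.cast_nonneg j)]
      calc (j : ℝ) * |G j| ≤ j * (2 * (C ^ 2 * ε j ^ 4) + C * ε j ^ 4) := by
            gcongr
            refine (abs_add_le _ _).trans (add_le_add ?_ e2)
            rw [abs_le]
            constructor <;> nlinarith [sq_nonneg (σ j * (a j - b))]
        _ = _ := by rw [hx]; ring
    have hexp := (Real.continuous_exp.tendsto 0).comp hGlim
    rw [Real.exp_zero] at hexp
    refine hexp.congr' ?_
    filter_upwards [hev] with j hj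
    obtain ⟨hj5, hj1, hj2, hj3⟩ := hj
    have e1 := hvC j hj1
    have hv : 0 < 1 + σ j * (a j - b) := by
      have := (abs_le.1 e1).1
      linarith
    have e := saddlePoint_mainTerm_eq (ht j) (rfl : ε j = j / t j) (hw j) hm0 (hLpos j hj1) hv
    have e' : M j = _ := e
    rw [e', hT]
    simp only [Function.comp]
    have hp : t j ^ j / (m ^ j * (j.factorial : ℝ)) ≠ 0 := by
      have := ht j
      positivity
    rw [mul_div_mul_left _ _ hp, ← Real.exp_sub, hG]
    congr 1
    simp only [hσ]
    ring
  have hWM : Tendsto (fun j => (convPow ν j).real (Iic (t j)) / M j) atTop (𝓝 1) := by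
    refine tendsto_one_of_forall_exp_bounds (fun δ => 4 * Real.exp (2 * δ) / δ ^ 2)
      (E := fun j => K * Real.exp 1 * √(x j) * Real.exp (2 * C ^ 2 * x j)) ?_ ?_
    · have e1 : Tendsto (fun j => √(x j)) atTop (𝓝 0) := by
        simpa [Function.comp_def] using (Real.continuous_sqrt.tendsto 0).comp hlim
      have e2 : Tendsto (fun j => Real.exp (2 * C ^ 2 * x j)) atTop (𝓝 1) := by
        have := hlim.const_mul (2 * C ^ 2)
        simpa [Function.comp_def] using (Real.continuous_exp.tendsto _).comp this
      simpa using (e1.const_mul (K * Real.exp 1)).mul e2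
    · intro δ hδ
      filter_upwards [hev, (tendsto_natCast_atTop_atTop (R := ℝ)).eventually_ge_atTop (8 * δ)]
        with j hj hjδ
      obtain ⟨hj5, hj1, hj2, hj3⟩ := hj
      have e1 := hvC j hj1
      have hv : 1 / 2 ≤ 1 + σ j * (a j - b) := by
        have := (abs_le.1 e1).1
        linarith
      have hj0 : 0 < j := by omega
      have hjr : (0 : ℝ) < j := by exact_mod_cast hj0
      have hLj := hLpos j hj1
      obtain ⟨hA1, hA2⟩ := saddlePoint_mul_eq (a := a j) (ht j) (rfl : ε j = j / t j) (hw j)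
      have hA : 0 < t j + j * a j := by
        rw [hA1]
        have := ht j
        have := hw j
        have hv0 : 0 < 1 + σ j * (a j - b) := by linarith
        exact mul_pos (mul_pos (ht j) hv0) (hw j)
      have hA2' : σ j * (t j + j * a j) = j * (1 + σ j * (a j - b)) := hA2
      have hMpos : 0 < M j := by positivity
      have hεj : 0 < ε j := div_pos hjr (ht j)
      have hσj : 0 < σ j := div_pos hεj (hw j)
      have hμ : Integrable (fun y : ℝ => Real.exp (-σ j * y)) (convPow ν j) := by
        have hν' : Integrable (fun y : ℝ => Complex.exp (-(σ j : ℂ) * y)) ν :=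
          integrable_cexp_sum_convPow hpos (by simpa using hσj)
        refine (integrable_cexp_convPow hν' j).norm.congr (Eventually.of_forall fun y => ?_)
        simp only
        rw [norm_cexp_neg_mul, Complex.ofReal_re]
      obtain ⟨hub, hlb⟩ := measureReal_Iic_bounds hσj hμ
        (N := (L j ^ j)⁻¹ * Real.exp (-σ j * (j * a j))) (P := K * ((σ j * L j) ^ j)⁻¹)
        (B := j * a j) (by positivity) (by positivity) (j := j)
        (fun s => (hsec (σ j) hσj ((hσε j).trans hj2) j hj5 s).trans (le_of_eq (by ring)))
        (t := t j) (δ := δ) hδ (by rw [hA2']; nlinarith) (by rw [hA2']; nlinarith)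
      have herr := saddlePoint_errorTerm_le hj0 (ht j) (rfl : ε j = j / t j) (hw j) hLj hv e1
      have herr' : Real.exp (σ j * t j) * ((σ j * L j) ^ j)⁻¹ ≤
          M j * (Real.exp 1 * √j * Real.exp (2 * C ^ 2 * x j)) := herr
      have hsx : ε j ^ 2 * √j = √(x j) := by
        rw [hx]
        simp only
        rw [Real.sqrt_mul hjr.le, show ε j ^ 4 = (ε j ^ 2) ^ 2 by ring,
          Real.sqrt_sq (sq_nonneg _), mul_comm]
      have hE : 4 * (K * ((σ j * L j) ^ j)⁻¹) * Real.exp (2 * δ) / δ ^ 2 *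
          (σ j ^ 2 * Real.exp (σ j * t j)) ≤ 4 * Real.exp (2 * δ) / δ ^ 2 *
          (K * Real.exp 1 * √(x j) * Real.exp (2 * C ^ 2 * x j)) * M j := by
        calc _ = 4 * Real.exp (2 * δ) / δ ^ 2 * (K * (σ j ^ 2 *
              (Real.exp (σ j * t j) * ((σ j * L j) ^ j)⁻¹))) := by ring
          _ ≤ 4 * Real.exp (2 * δ) / δ ^ 2 * (K * (ε j ^ 2 *
              (M j * (Real.exp 1 * √j * Real.exp (2 * C ^ 2 * x j))))) := by
            have := hσε j
            gcongr
          _ = _ := by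
            rw [← hsx]
            ring
      rw [div_le_iff₀ hMpos, le_div_iff₀ hMpos, add_mul, sub_mul]
      constructor
      · calc _ ≤ _ := hub
          _ ≤ _ := add_le_add (le_of_eq (mul_comm _ _)) hE
      · calc _ ≤ _ := sub_le_sub (le_of_eq (mul_comm _ _)) hE
          _ ≤ _ := hlb
  have hprod := hWM.mul hMT
  rw [mul_one] at hprod
  refine hprod.congr' ?_
  filter_upwards [hev] with j hj
  obtain ⟨hj5, hj1, hj2, hj3⟩ := hj
  have e1 := hvC j hj1
  have hv : 0 < 1 + σ j * (a j - b) := by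
    have := (abs_le.1 e1).1
    linarith
  have hLj := hLpos j hj1
  have hA : 0 < t j + j * a j := by
    rw [(saddlePoint_mul_eq (a := a j) (ht j) (rfl : ε j = j / t j) (hw j)).1]
    exact mul_pos (mul_pos (ht j) hv) (hw j)
  have hMpos : 0 < M j := by positivity
  rw [div_mul_div_cancel₀ hMpos.ne']

end SumConvPow

/-- Asymptotics of the convolution powers of the renewal function `U` of an a.s. positive
random variable `ξ` with distribution `ρ`, `E[ξ⁵] < ∞`, some convolution power of `ρ`
having a nonzero absolutely continuous component: for `j = o(t_j^{4/5})`,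
`U^{*(j)}(t_j) ~ (t_j^j/(𝔪^j j!)) exp(b₁ j²/t_j + b₂ j³/t_j² + b₃ j⁴/t_j³)`.
Here `ν = Σ_{n≥0} ρ^{*n}` is the renewal measure, i.e. the Lebesgue–Stieltjes measure
of `U(t) = 1 + Σ_{n≥1} P{ξ₁ + … + ξ_n ≤ t}`. -/
theorem renewal_function_convPow_asymptotics
    (ρ : Measure ℝ) [IsProbabilityMeasure ρ]
    -- ξ is a.s. positive
    (hpos : ρ {x : ℝ | x ≤ 0} = 0)
    -- E[ξ⁵] < ∞
    (hmom : Integrable (fun x : ℝ => x ^ 5) ρ)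
    -- some convolution power of ρ has a nonzero absolutely continuous component
    (hac : ∃ n : ℕ, 1 ≤ n ∧ ¬ (convPow ρ n).MutuallySingular volume)
    -- 𝔪 = E[ξ]
    (m : ℝ) (hm : m = ∫ x, x ∂ρ)
    (b₁ b₂ b₃ : ℝ)
    (hb₁ : b₁ = (∫ x, x ^ 2 ∂ρ) / (2 * m))
    (hb₂ : b₂ = -(∫ x, x ^ 3 ∂ρ) / (6 * m))
    (hb₃ : b₃ = (1 / 24) * ((∫ x, x ^ 4 ∂ρ) / m
        + 2 * (∫ x, x ^ 2 ∂ρ) * (∫ x, x ^ 3 ∂ρ) / m ^ 2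
        - (∫ x, x ^ 2 ∂ρ) ^ 3 / m ^ 3))
    -- the renewal measure ν, the Lebesgue–Stieltjes measure of the renewal function U
    (ν : Measure ℝ) (hν : ν = Measure.sum fun n : ℕ => convPow ρ n)
    (U : ℝ → ℝ)
    (hU : ∀ t : ℝ, 0 ≤ t →
      U t = 1 + ∑' n : ℕ, ((convPow ρ (n + 1)) (Set.Iic t)).toReal)
    (hUν : ∀ t : ℝ, 0 ≤ t → (ν (Set.Icc 0 t)).toReal = U t)
    -- t_j → ∞ with j = o(t_j^{4/5})
    (t : ℕ → ℝ) (htpos : ∀ j, 0 < t j) (ht : Tendsto t atTop atTop)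
    (hjo : (fun j : ℕ => (j : ℝ)) =o[atTop] fun j : ℕ => t j ^ ((4 : ℝ) / 5)) :
    (fun j : ℕ => ((convPow ν j) (Set.Icc 0 (t j))).toReal) ~[atTop]
      (fun j : ℕ => t j ^ j / (m ^ j * (Nat.factorial j : ℝ)) *
        Real.exp (b₁ * (j : ℝ) ^ 2 / t j + b₂ * (j : ℝ) ^ 3 / t j ^ 2
          + b₃ * (j : ℝ) ^ 4 / t j ^ 3)) := by
  have hae := ae_pos_of_measure_nonpos hpos
  have hk : ∀ k ≤ 5, Integrable (fun x : ℝ => x ^ k) ρ := fun k hk => by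
    refine ((integrable_const (1 : ℝ)).add hmom).mono' (by fun_prop) ?_
    filter_upwards [hae] with x hx
    rw [Real.norm_of_nonneg (by positivity)]
    simp only [Pi.add_apply]
    rcases le_total x 1 with h | h
    · have := pow_le_one₀ hx.le h (n := k)
      have := pow_pos hx 5
      linarith
    · have := pow_le_pow_right₀ h hk
      linarith
  have h1 : Integrable (fun x : ℝ => x) ρ := by simpa using hk 1 (by norm_num)
  have hm0 : 0 < m := hm ▸ integral_id_pos hae h1
  have hlim : Tendsto (fun j : ℕ => (j : ℝ) * (j / t j) ^ 4) atTop (𝓝 0) := by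
    have h := hjo.tendsto_div_nhds_zero.pow 5
    rw [zero_pow (by norm_num)] at h
    refine h.congr fun j => ?_
    rw [div_pow, ← Real.rpow_natCast (t j ^ ((4 : ℝ) / 5)), ← Real.rpow_mul (htpos j).le,
      show (4 : ℝ) / 5 * ((5 : ℕ) : ℝ) = ((4 : ℕ) : ℝ) by norm_num, Real.rpow_natCast]
    ring
  have hmain := tendsto_convPow_sum_convPow_div hae h1 (hk 2 (by norm_num)) (hk 3 (by norm_num))
    (hk 4 (by norm_num)) hmom (m := m) (b := b₁) (c := -b₂)
    (d := (∫ x, x ^ 4 ∂ρ) / (24 * m)) hm.symm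
    (by rw [hb₁]; field_simp) (by rw [hb₂]; field_simp) (by field_simp) htpos hlim
  have hb₃' : (∫ x, x ^ 4 ∂ρ) / (24 * m) + b₁ * -b₂ - b₁ ^ 3 / 3 = b₃ := by
    rw [hb₁, hb₂, hb₃]
    field_simp
    ring
  rw [hb₃', ← hν] at hmain
  have hν0 : ν (Iio 0) = 0 := by
    rw [hν, Measure.sum_apply _ measurableSet_Iio, ENNReal.tsum_eq_zero]
    exact fun n => convPow_Iio_zero (measure_mono_null (t := {x | x ≤ 0}) (fun x hx => (mem_Iio.1 hx).le) hpos) n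
  have hνs : SFinite ν := by
    rw [hν]
    infer_instance
  have hW : ∀ j, ((convPow ν j) (Set.Icc 0 (t j))).toReal = (convPow ν j).real (Iic (t j)) :=
    fun j => by
      rw [Measure.real, ← measure_sdiff_null (convPow_Iio_zero hν0 j) (s := Iic (t j))]
      congr 2
      ext y
      simp [and_comm]
  refine isEquivalent_of_tendsto_one (hmain.congr fun j => ?_)
  rw [Pi.div_apply, hW]
  congr 3
  have := (htpos j).ne'
  field_simp
  ring
end
end
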